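/- arXiv:2312.13943 — 2 statements merged into one kernel-verified Lean document; each statement's English description precedes it below -/
import Mathlib

section
/- Fix σ < 0. For t ≥ 1 and s = σ + it, ζ(qs)/s = e^{−iπ/4} (2π/q)^{qσ−1/2} t^{−1/2−qσ} ∑_{n=1}^∞ n^{qσ−1} (2nπe/(qt))^{qit} + O(t^{−3/2−qσ}), where the implied constant depends on σ and q. -/
open Complex Filter Topology

/-- Stirling's approximation to `Γ`, without the factor `√(2π)`. -/
noncomputable def stirlingApprox (z : ℂ) : ℂ := exp ((z - 1 / 2) * log z - z)

/-- The general term of the series expressing the error in Stirling's approximation. -/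
noncomputable def binetTerm (z : ℂ) : ℂ := (z + 1 / 2) * log (1 + 1 / z) - 1

lemma stirlingApprox_ne_zero (z : ℂ) : stirlingApprox z ≠ 0 := exp_ne_zero _

lemma log_mul_of_re_pos {x y : ℂ} (hx : 0 < x.re) (hy : 0 < y.re) :
    log (x * y) = log x + log y := by
  have hx₀ : x ≠ 0 := fun h => by simp [h] at hx
  have hy₀ : y ≠ 0 := fun h => by simp [h] at hy
  rw [log_mul_eq_add_log_iff hx₀ hy₀]
  have h1 := abs_lt.mp (abs_arg_lt_pi_div_two_iff.mpr (Or.inl hx))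
  have h2 := abs_lt.mp (abs_arg_lt_pi_div_two_iff.mpr (Or.inl hy))
  constructor <;> linarith [h1.1, h1.2, h2.1, h2.2]

lemma one_div_re_pos {z : ℂ} (hz : 0 < z.re) : 0 < (1 / z).re := by
  have hz₀ : z ≠ 0 := fun h => by simp [h] at hz
  rw [one_div, inv_re]
  exact div_pos hz (normSq_pos.mpr hz₀)

lemma log_add_one_of_re_pos {z : ℂ} (hz : 0 < z.re) :
    log (z + 1) = log z + log (1 + 1 / z) := by
  have hz₀ : z ≠ 0 := fun h => by simp [h] at hz
  rw [← log_mul_of_re_pos hz (by rw [add_re, one_re]; linarith [one_div_re_pos hz])]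
  congr 1
  field_simp

lemma Gamma_div_stirlingApprox_succ {z : ℂ} (hz : 0 < z.re) :
    Gamma z / stirlingApprox z =
      exp (binetTerm z) * (Gamma (z + 1) / stirlingApprox (z + 1)) := by
  have hz₀ : z ≠ 0 := fun h => by simp [h] at hz
  have h : stirlingApprox (z + 1) = z * stirlingApprox z * exp (binetTerm z) := by
    rw [stirlingApprox, stirlingApprox, binetTerm, log_add_one_of_re_pos hz]
    have : exp ((z + 1 - 1 / 2) * (log z + log (1 + 1 / z)) - (z + 1)) = exp (log z) *
        exp ((z - 1 / 2) * log z - z) * exp ((z + 1 / 2) * log (1 + 1 / z) - 1) := by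
      rw [← exp_add, ← exp_add]
      congr 1
      ring
    rw [this, exp_log hz₀]
  rw [Gamma_add_one z hz₀, h]
  field_simp [stirlingApprox_ne_zero z, exp_ne_zero]

lemma Gamma_div_stirlingApprox_add_nat {z : ℂ} (hz : 0 < z.re) (n : ℕ) :
    Gamma z / stirlingApprox z = exp (∑ k ∈ Finset.range n, binetTerm (z + k)) *
      (Gamma (z + n) / stirlingApprox (z + n)) := by
  induction n with
  | zero => simp
  | succ n ih =>
    have h : 0 < (z + n).re := by
      simp only [add_re, natCast_re]; positivity
    rw [ih, Gamma_div_stirlingApprox_succ h, Finset.sum_range_succ, exp_add, Nat.cast_succ]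
    ring_nf

lemma norm_binetTerm_le {z : ℂ} (hz : 2 ≤ ‖z‖ ^ 2) : ‖binetTerm z‖ ≤ 3 / ‖z‖ ^ 2 := by
  have hz₀ : z ≠ 0 := fun h => by simp [h] at hz; linarith
  set w : ℂ := 1 / z with hw
  have hw₀ : w ≠ 0 := by simp [hw, hz₀]
  have hzw : z = 1 / w := by simp [hw]
  have hn : ‖w‖ ^ 2 ≤ 1 / 2 := by
    rw [hw, norm_div, norm_one, div_pow, one_pow]
    exact one_div_le_one_div_of_le (by norm_num) hz
  have hn1 : ‖w‖ ≤ 3 / 4 := by nlinarith [norm_nonneg w]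
  set R := log (1 + w) - logTaylor 3 w with hR
  have hRle : ‖R‖ ≤ ‖w‖ ^ 3 * (4 / 3) := by
    refine (norm_log_sub_logTaylor_le 2 (by linarith)).trans ?_
    have : (1 - ‖w‖)⁻¹ ≤ 4 := by
      rw [inv_le_comm₀ (by linarith) (by norm_num)]; linarith
    calc _ ≤ ‖w‖ ^ 3 * 4 / 3 := by push_cast; norm_num; gcongr
      _ = _ := by ring
  have hlog : log (1 + w) = w - w ^ 2 / 2 + R := by
    rw [hR]; simp [logTaylor_succ, logTaylor_zero]; ring
  have key : binetTerm z = - w ^ 2 / 4 + R / w + R / 2 := by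
    rw [binetTerm, ← hw, hlog, hzw]; field_simp; ring
  have h3 : 3 / ‖z‖ ^ 2 = 3 * ‖w‖ ^ 2 := by rw [hw, norm_div, norm_one]; ring
  have hwp : 0 < ‖w‖ := norm_pos_iff.mpr hw₀
  rw [key, h3]
  have e1 : ‖- w ^ 2 / 4‖ = ‖w‖ ^ 2 / 4 := by simp
  have e2 : ‖R / w‖ ≤ ‖w‖ ^ 2 * (4 / 3) := by
    rw [norm_div, div_le_iff₀ hwp]; linarith [hRle]
  have e3 : ‖R / 2‖ ≤ ‖w‖ ^ 2 * (2 / 3) := by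
    rw [norm_div, norm_ofNat]; nlinarith [sq_nonneg ‖w‖]
  calc _ ≤ ‖- w ^ 2 / 4‖ + ‖R / w‖ + ‖R / 2‖ := norm_add₃_le
    _ ≤ _ := by rw [e1]; nlinarith [sq_nonneg ‖w‖]

lemma norm_sum_binetTerm_le {z : ℂ} {T : ℝ} (hz : 1 ≤ z.re) (hT : 1 ≤ T) (hzT : z.im ^ 2 = T ^ 2)
    (n : ℕ) : ‖∑ k ∈ Finset.range n, binetTerm (z + k)‖ ≤ 12 / T := by
  have key : ∀ k : ℕ, ‖binetTerm (z + k)‖ ≤ 6 / (k + T - 1 / 2) - 6 / ((k + 1 : ℕ) + T - 1 / 2) := by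
    intro k
    have hk : (0 : ℝ) ≤ k := k.cast_nonneg
    have hsq : ‖z + k‖ ^ 2 = (z.re + k) ^ 2 + T ^ 2 := by
      rw [← normSq_eq_norm_sq, normSq_apply, ← hzT]; simp; ring
    have h1 : (k + T) ^ 2 / 2 ≤ ‖z + k‖ ^ 2 := by
      rw [hsq]; nlinarith [sq_nonneg (k - T)]
    refine (norm_binetTerm_le (by rw [hsq]; nlinarith)).trans ?_
    have h2 : (0 : ℝ) < k + T - 1 / 2 := by linarith
    calc 3 / ‖z + k‖ ^ 2 ≤ 3 / ((k + T) ^ 2 / 2) := by gcongr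
      _ ≤ 6 / ((k + T - 1 / 2) * (k + T + 1 / 2)) := by
        rw [div_le_div_iff₀ (by positivity) (by positivity)]; nlinarith
      _ = _ := by
        push_cast
        have h3 : (0 : ℝ) < k + 1 + T - 1 / 2 := by linarith
        have h4 : (k + T + 1 / 2 : ℝ) = k + 1 + T - 1 / 2 := by ring
        rw [h4, div_sub_div _ _ h2.ne' h3.ne']
        ring
  refine (norm_sum_le _ _).trans ((Finset.sum_le_sum fun k _ => key k).trans ?_)
  rw [Finset.sum_range_sub' (fun k : ℕ => 6 / ((k : ℝ) + T - 1 / 2))]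
  have h5 : (0 : ℝ) ≤ 6 / ((n : ℝ) + T - 1 / 2) :=
    div_nonneg (by norm_num) (by linarith [(n.cast_nonneg : (0 : ℝ) ≤ n)])
  have h6 : 6 / (((0 : ℕ) : ℝ) + T - 1 / 2) ≤ 12 / T := by
    rw [Nat.cast_zero, div_le_div_iff₀ (by linarith) (by linarith)]; linarith
  linarith

lemma Gamma_add_nat_succ {z : ℂ} (hz : 0 < z.re) (n : ℕ) :
    Gamma (z + (n + 1 : ℕ)) = Gamma z * ∏ j ∈ Finset.range (n + 1), (z + j) := by
  have : ∀ m : ℕ, Gamma (z + m) = Gamma z * ∏ j ∈ Finset.range m, (z + j) := by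
    intro m
    induction m with
    | zero => simp
    | succ m ih =>
      have h : z + m ≠ 0 := fun h => by
        have := congrArg re h
        simp only [add_re, natCast_re, zero_re] at this
        linarith [(m.cast_nonneg : (0 : ℝ) ≤ m)]
      rw [Finset.prod_range_succ, ← mul_assoc, ← ih, mul_comm, ← Gamma_add_one _ h]
      push_cast; ring_nf
  exact this _

lemma tendsto_Gamma_div_stirlingApprox_add_nat {z : ℂ} (hz : 0 < z.re) :
    Tendsto (fun n : ℕ => Gamma (z + n) / stirlingApprox (z + n)) atTop
      (𝓝 ((√(2 * Real.pi) : ℝ) : ℂ)) := by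
  rw [← tendsto_add_atTop_iff_nat 1]
  have hΓ : Gamma z ≠ 0 := Gamma_ne_zero_of_re_pos hz
  have h1 : Tendsto (fun n : ℕ => Gamma z / GammaSeq z n) atTop (𝓝 1) := by
    simpa [div_self hΓ, Pi.div_def] using (tendsto_const_nhds (x := Gamma z)).div (GammaSeq_tendsto_Gamma z) hΓ
  have h2 : Tendsto (fun n : ℕ => ((Stirling.stirlingSeq n * √2 : ℝ) : ℂ)) atTop
      (𝓝 ((√(2 * Real.pi) : ℝ) : ℂ)) := by
    rw [mul_comm 2, Real.sqrt_mul Real.pi_pos.le]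
    exact (continuous_ofReal.tendsto _).comp (Stirling.tendsto_stirlingSeq_sqrt_pi.mul_const _)
  have h0 : Tendsto (fun n : ℕ => (z + 1) / n) atTop (𝓝 0) :=
    tendsto_const_div_atTop_nhds_zero_nat _
  have h3 : Tendsto (fun n : ℕ => (n : ℂ) * log (1 + (z + 1) / n)) atTop (𝓝 (z + 1)) := by
    refine tendsto_nat_mul_log_one_add_of_tendsto ?_
    refine tendsto_const_nhds.congr' ?_
    filter_upwards [eventually_ne_atTop 0] with n hn
    have : (n : ℂ) ≠ 0 := by exact_mod_cast hn
    field_simp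
  have h4 : Tendsto (fun n : ℕ => log (1 + (z + 1) / n)) atTop (𝓝 0) := by
    have : Tendsto (fun n : ℕ => 1 + (z + 1) / n) atTop (𝓝 1) := by simpa using h0.const_add 1
    simpa [Function.comp_def] using ((continuousAt_clog one_mem_slitPlane).tendsto.comp this)
  have h5 : Tendsto (fun n : ℕ => exp (z + 1 - (n * log (1 + (z + 1) / n) +
      (z + 1 / 2) * log (1 + (z + 1) / n)))) atTop (𝓝 1) := by
    have := (continuous_exp.tendsto _).comp ((h3.add (h4.const_mul (z + 1 / 2))).const_sub (z + 1))
    simpa [Function.comp_def] using this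
  have := (h1.mul h2).mul h5
  simp only [one_mul, mul_one] at this
  refine this.congr' ?_
  filter_upwards [eventually_ne_atTop 0] with n hn
  have hnp : (0 : ℝ) < n := by exact_mod_cast Nat.pos_of_ne_zero hn
  have hnc : (n : ℂ) ≠ 0 := by exact_mod_cast hn
  have hlog : log (z + (n + 1 : ℕ)) = (Real.log n : ℝ) + log (1 + (z + 1) / n) := by
    rw [← log_ofReal_mul hnp]
    · congr 1; push_cast; field_simp; ring
    · intro h
      have h' : z + 1 + n = 0 := by
        field_simp at h; linear_combination h
      have := congrArg re h'
      simp at this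
      linarith
  have hprod : ∏ j ∈ Finset.range (n + 1), (z + j) ≠ 0 := by
    have h := Gamma_add_nat_succ hz n
    have h' : Gamma (z + (n + 1 : ℕ)) ≠ 0 := Gamma_ne_zero_of_re_pos (by
      simp only [add_re, natCast_re]; positivity)
    rw [h] at h'
    exact right_ne_zero_of_mul h'
  have hfac : ((n.factorial : ℝ) : ℂ) = ((Stirling.stirlingSeq n * √2 : ℝ) : ℂ) *
      exp ((n + 1 / 2) * (Real.log n : ℝ) - n) := by
    have : (n.factorial : ℝ) = Stirling.stirlingSeq n * √2 *
        Real.exp ((n + 1 / 2) * Real.log n - n) := by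
      have e : Real.exp ((n + 1 / 2) * Real.log n - n) = √n * (n / Real.exp 1) ^ n := by
        rw [Real.sqrt_eq_rpow, Real.rpow_def_of_pos hnp, div_pow, ← Real.exp_nat_mul,
          ← Real.rpow_natCast (n : ℝ) n, Real.rpow_def_of_pos hnp, ← Real.exp_sub, ← Real.exp_add]
        congr 1; ring
      rw [e, Stirling.stirlingSeq, Real.sqrt_mul (by norm_num)]
      have : (n / Real.exp 1) ^ n ≠ 0 := by positivity
      field_simp
    rw [this]; push_cast; rfl
  rw [Gamma_add_nat_succ hz, GammaSeq, stirlingApprox, hlog, eq_div_iff (exp_ne_zero _)]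
  have hfac' : (n.factorial : ℂ) = ((n.factorial : ℝ) : ℂ) := by push_cast; rfl
  have hS : ((Stirling.stirlingSeq n * √2 : ℝ) : ℂ) ≠ 0 := by
    intro h; rw [h, zero_mul] at hfac
    exact n.factorial_ne_zero (by exact_mod_cast hfac)
  rw [hfac', hfac, cpow_def_of_ne_zero hnc]
  have hl : log (n : ℂ) = (Real.log n : ℝ) := by
    rw [ofReal_log hnp.le]; rfl
  rw [hl]
  set A := ((Stirling.stirlingSeq n * √2 : ℝ) : ℂ)
  set P := ∏ j ∈ Finset.range (n + 1), (z + j)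
  set l := log (1 + (z + 1) / n)
  set r := ((Real.log n : ℝ) : ℂ)
  have hexp : exp (z + 1 - (n * l + (z + 1 / 2) * l)) *
      exp ((z + (n + 1 : ℕ) - 1 / 2) * (r + l) - (z + (n + 1 : ℕ))) =
      exp (r * z) * exp ((n + 1 / 2) * r - n) := by
    rw [← exp_add, ← exp_add]; congr 1; push_cast; ring
  rw [mul_assoc, hexp]
  have hE1 := exp_ne_zero (r * z)
  have hE2 := exp_ne_zero ((n + 1 / 2) * r - n)
  field_simp

/-- Stirling's formula on vertical lines, with error term. -/
lemma norm_Gamma_div_stirlingApprox_sub_one_le {z : ℂ} {T : ℝ} (hz : 1 ≤ z.re) (hT : 1 ≤ T)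
    (hzT : z.im ^ 2 = T ^ 2) :
    ‖Gamma z / (((√(2 * Real.pi) : ℝ) : ℂ) * stirlingApprox z) - 1‖ ≤ 12 * Real.exp 12 / T := by
  have hz' : 0 < z.re := by linarith
  set c : ℂ := ((√(2 * Real.pi) : ℝ) : ℂ) with hc
  have hc₀ : c ≠ 0 := by rw [hc, ofReal_ne_zero]; positivity
  have hlim := tendsto_Gamma_div_stirlingApprox_add_nat hz'
  have key : ‖Gamma z / stirlingApprox z - c‖ ≤ 12 * Real.exp 12 / T * ‖c‖ := by
    refine le_of_tendsto_of_tendsto ((hlim.const_sub _).norm) (hlim.norm.const_mul _)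
      (Eventually.of_forall fun n => ?_)
    simp only
    rw [Gamma_div_stirlingApprox_add_nat hz' n]
    set S := ∑ k ∈ Finset.range n, binetTerm (z + k)
    have hS : ‖S‖ ≤ 12 / T := norm_sum_binetTerm_le hz hT hzT n
    have hS' : ‖S‖ ≤ 12 := hS.trans (div_le_self (by norm_num) hT)
    have : ‖exp S - 1‖ ≤ 12 * Real.exp 12 / T := by
      have := norm_exp_sub_sum_le_norm_mul_exp S 1
      simp at this
      calc _ ≤ _ := this
        _ ≤ 12 / T * Real.exp 12 := by gcongr
        _ = _ := by ring
    rw [← sub_one_mul, norm_mul]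
    gcongr
  have e : Gamma z / (c * stirlingApprox z) - 1 = (Gamma z / stirlingApprox z - c) / c := by
    have := stirlingApprox_ne_zero z
    field_simp
  rw [e, norm_div, div_le_iff₀ (norm_pos_iff.mpr hc₀)]
  exact key

lemma norm_log_one_add_mul_I_sub_le (x : ℝ) : ‖log (1 + x * I) - x * I‖ ≤ 20 * x ^ 2 := by
  have hn : ‖(x : ℂ) * I‖ = |x| := by simp
  rcases lt_or_ge |x| (1 / 2) with h | h
  · refine (norm_log_one_add_sub_self_le (by rw [hn]; linarith)).trans ?_
    rw [hn, sq_abs]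
    have : (1 - |x|)⁻¹ ≤ 2 := by
      rw [inv_le_comm₀ (by linarith) (by norm_num)]; linarith
    nlinarith [mul_le_mul_of_nonneg_left this (sq_nonneg x), sq_nonneg x]
  · have h1 : 1 ≤ ‖1 + x * I‖ := by
      have := abs_re_le_norm (1 + x * I)
      simpa using this
    have h2 : ‖1 + x * I‖ ≤ 1 + |x| := by
      simpa [hn] using norm_add_le (1 : ℂ) (x * I)
    have h3 : |(log (1 + x * I)).re| ≤ |x| := by
      rw [log_re, abs_of_nonneg (Real.log_nonneg h1)]
      linarith [Real.log_le_sub_one_of_pos (by linarith : 0 < ‖1 + x * I‖)]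
    have h4 : |(log (1 + x * I)).im| ≤ 4 := by
      rw [log_im]; exact (abs_arg_le_pi _).trans Real.pi_le_four
    have h5 := norm_le_abs_re_add_abs_im (log (1 + x * I))
    have h6 := norm_sub_le (log (1 + x * I)) (x * I)
    rw [hn] at h6
    rw [← sq_abs]
    nlinarith

lemma log_sub_mul_I {a T : ℝ} (ha : 0 < a) (hT : 0 < T) :
    log (a - T * I) = (Real.log T : ℝ) - Real.pi / 2 * I + log (1 + (a / T : ℝ) * I) := by
  set w : ℂ := 1 + (a / T : ℝ) * I with hw
  have hre : 0 < w.re := by simp [hw]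
  have hw₀ : w ≠ 0 := fun h => by simp [h] at hre
  have hT₀ : (T : ℂ) ≠ 0 := by exact_mod_cast hT.ne'
  have e : (a - T * I : ℂ) = (T : ℝ) * (-I * w) := by
    rw [hw]; push_cast; field_simp; linear_combination (a : ℂ) * I_sq
  have him : 0 < w.im := by simp [hw]; positivity
  rw [e, log_ofReal_mul hT (mul_ne_zero (neg_ne_zero.mpr I_ne_zero) hw₀),
    (log_mul_eq_add_log_iff (neg_ne_zero.mpr I_ne_zero) hw₀).mpr, log_neg_I]
  · ring
  · have := abs_lt.mp (abs_arg_lt_pi_div_two_iff.mpr (Or.inl hre))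
    rw [arg_neg_I]
    constructor <;> linarith [this.1, this.2, Real.pi_pos]

lemma norm_exp_sub_one_le_of_le {x : ℂ} {K T : ℝ} (hK : 0 ≤ K) (hT : 1 ≤ T) (hx : ‖x‖ ≤ K / T) :
    ‖exp x - 1‖ ≤ K * Real.exp K / T := by
  have hx' : ‖x‖ ≤ K := hx.trans (div_le_self hK hT)
  have := norm_exp_sub_sum_le_norm_mul_exp x 1
  simp only [Finset.range_one, Finset.sum_singleton, pow_zero, Nat.factorial_zero, Nat.cast_one,
    div_one, pow_one] at this
  calc _ ≤ _ := this
    _ ≤ K / T * Real.exp K := by gcongr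
    _ = _ := by ring

lemma norm_mul_sub_one_le {u v : ℂ} {A B T : ℝ} (hT : 1 ≤ T) (hA : 0 ≤ A) (hB : 0 ≤ B)
    (hu : ‖u - 1‖ ≤ A / T) (hv : ‖v - 1‖ ≤ B / T) : ‖u * v - 1‖ ≤ (A * B + A + B) / T := by
  have e : u * v - 1 = (u - 1) * (v - 1) + (u - 1) + (v - 1) := by ring
  have h1 : ‖(u - 1) * (v - 1)‖ ≤ A * B / T := by
    rw [norm_mul]
    calc _ ≤ A / T * B := by gcongr; exact hv.trans (div_le_self hB hT)
      _ = _ := by ring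
  rw [e, add_div, add_div]
  exact norm_add₃_le.trans (by linarith)

/-- The asymptotics of the factor in the functional equation of `ζ` along a vertical line. -/
lemma exists_functional_factor_eq {a : ℝ} (ha : 1 ≤ a) : ∃ C : ℝ, 0 ≤ C ∧ ∀ T : ℝ, 1 ≤ T →
    ∃ E : ℂ, ‖E - 1‖ ≤ C / T ∧
      2 * (2 * Real.pi : ℂ) ^ (-(a - T * I) : ℂ) * Gamma (a - T * I) *
        cos (Real.pi * (a - T * I) / 2) =
      exp ((Real.log (2 * Real.pi) : ℝ) * (1 / 2 - (a - T * I)) +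
        (Real.log T : ℝ) * ((a - T * I) - 1 / 2) + Real.pi / 4 * I + T * I) * E := by
  set K : ℝ := a ^ 2 + 20 * a ^ 2 * (a + 1) with hK
  have hK₀ : 0 ≤ K := by positivity
  set A := 12 * Real.exp 12
  set B := K * Real.exp K
  have hA : 0 ≤ A := by positivity
  have hB : 0 ≤ B := by positivity
  refine ⟨(A * B + A + B) * 1 + (A * B + A + B) + 1, by positivity, fun T hT => ?_⟩
  have hT0 : 0 < T := by linarith
  have hTc : (T : ℂ) ≠ 0 := by exact_mod_cast hT0.ne'
  set z : ℂ := a - T * I with hz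
  have hzre : z.re = a := by simp [hz]
  have hzim : z.im = -T := by simp [hz]
  set r := log (1 + (a / T : ℝ) * I) - (a / T : ℝ) * I with hr
  set d : ℂ := (z - 1 / 2) * log (1 + (a / T : ℝ) * I) - a with hd
  have hS : stirlingApprox z =
      exp ((z - 1 / 2) * ((Real.log T : ℝ) - Real.pi / 2 * I) + T * I) * exp d := by
    rw [stirlingApprox, ← exp_add, hz, log_sub_mul_I (by linarith) hT0, ← hz, hd]
    congr 1
    rw [hz]; ring
  have hdK : ‖d‖ ≤ K / T := by
    have e : d = (a - 1 / 2 : ℝ) * (a / T : ℝ) * I + ((a - 1 / 2 : ℝ) - T * I) * r := by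
      rw [hd, hr, hz]; push_cast; field_simp; linear_combination (-2 * a * T : ℂ) * I_sq
    have hr' : ‖r‖ ≤ 20 * (a / T) ^ 2 := norm_log_one_add_mul_I_sub_le _
    have h1 : ‖((a - 1 / 2 : ℝ) : ℂ) * (a / T : ℝ) * I‖ ≤ a * (a / T) := by
      rw [norm_mul, norm_mul, norm_I, norm_real, norm_real, Real.norm_of_nonneg (by linarith),
        Real.norm_of_nonneg (by positivity), mul_one]
      gcongr; linarith
    have h2 : ‖((a - 1 / 2 : ℝ) : ℂ) - T * I‖ ≤ (a + 1) * T := by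
      refine (norm_sub_le _ _).trans ?_
      rw [norm_mul, norm_I, norm_real, norm_real, Real.norm_of_nonneg (by linarith),
        Real.norm_of_nonneg hT0.le]
      nlinarith
    rw [e]
    calc _ ≤ _ := norm_add_le _ _
      _ ≤ a * (a / T) + (a + 1) * T * (20 * (a / T) ^ 2) := by
        rw [norm_mul _ r]; gcongr
      _ = K / T := by rw [hK]; field_simp
  set g := Gamma z / (((√(2 * Real.pi) : ℝ) : ℂ) * stirlingApprox z) with hg
  have hg1 : ‖g - 1‖ ≤ A / T :=
    norm_Gamma_div_stirlingApprox_sub_one_le (by rw [hzre]; exact ha) hT (by rw [hzim]; ring)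
  have hsq : ((√(2 * Real.pi) : ℝ) : ℂ) ≠ 0 := by rw [ofReal_ne_zero]; positivity
  have hΓ : Gamma z = g * (((√(2 * Real.pi) : ℝ) : ℂ) * stirlingApprox z) := by
    rw [hg, div_mul_cancel₀]
    exact mul_ne_zero hsq (stirlingApprox_ne_zero z)
  have hc1 : ‖(1 + exp (-(Real.pi * z * I))) - 1‖ ≤ 1 / T := by
    rw [add_sub_cancel_left, norm_exp]
    have : (-(Real.pi * z * I)).re = -(Real.pi * T) := by simp [hzim]
    rw [this, Real.exp_neg, ← one_div]
    gcongr
    nlinarith [Real.add_one_le_exp (Real.pi * T), Real.pi_gt_three]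
  refine ⟨g * exp d * (1 + exp (-(Real.pi * z * I))), ?_, ?_⟩
  · exact norm_mul_sub_one_le hT (by positivity) zero_le_one
      (norm_mul_sub_one_le hT hA hB hg1 (norm_exp_sub_one_le_of_le hK₀ hT hdK)) hc1
  · have hcos : 2 * cos (Real.pi * z / 2) =
        exp (Real.pi * z / 2 * I) * (1 + exp (-(Real.pi * z * I))) := by
      rw [cos, mul_add, ← exp_add]; ring_nf
    have h2π : (0 : ℝ) < 2 * Real.pi := by positivity
    have hpow : (2 * Real.pi : ℂ) ^ (-z) = exp ((Real.log (2 * Real.pi) : ℝ) * (-z)) := by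
      rw [cpow_def_of_ne_zero (by exact_mod_cast h2π.ne'), ofReal_log h2π.le]; push_cast; rfl
    have hsqrt : ((√(2 * Real.pi) : ℝ) : ℂ) = exp ((Real.log (2 * Real.pi) : ℝ) * (1 / 2)) := by
      rw [Real.sqrt_eq_rpow, Real.rpow_def_of_pos h2π]; push_cast; rfl
    calc _ = (2 * Real.pi : ℂ) ^ (-z) * Gamma z * (2 * cos (Real.pi * z / 2)) := by ring
      _ = exp ((Real.log (2 * Real.pi) : ℝ) * (-z)) *
          exp ((Real.log (2 * Real.pi) : ℝ) * (1 / 2)) *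
          exp ((z - 1 / 2) * ((Real.log T : ℝ) - Real.pi / 2 * I) + T * I) *
          exp (Real.pi * z / 2 * I) * (g * exp d * (1 + exp (-(Real.pi * z * I)))) := by
        rw [hcos, hpow, hΓ, hS, hsqrt]; ring
      _ = _ := by
        rw [← exp_add, ← exp_add, ← exp_add]
        congr 2
        ring

lemma ofReal_cpow_eq_exp {x : ℝ} (hx : 0 < x) (w : ℂ) :
    (x : ℂ) ^ w = exp ((Real.log x : ℝ) * w) := by
  rw [cpow_def_of_ne_zero (by exact_mod_cast hx.ne'), ofReal_log hx.le]

lemma ofReal_rpow_eq_exp {x : ℝ} (hx : 0 < x) (y : ℝ) :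
    ((x ^ y : ℝ) : ℂ) = exp ((Real.log x : ℝ) * (y : ℂ)) := by
  rw [ofReal_cpow hx.le, ofReal_cpow_eq_exp hx]

/-- for fixed `σ < 0` and `t ≥ 1`, with `s = σ + it`,
`ζ(qs)/s = e^{-iπ/4} (2π/q)^{qσ-1/2} t^{-1/2-qσ} ∑_{n≥1} n^{qσ-1} (2nπe/(qt))^{qit}
+ O(t^{-3/2-qσ})`. -/
theorem stmt_11 (q : ℕ) (hq : 1 ≤ q) (σ : ℝ) (hσ : σ < 0) :
    ∃ C : ℝ, ∀ t : ℝ, 1 ≤ t →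
      ‖riemannZeta ((q : ℂ) * ((σ : ℂ) + (t : ℂ) * I)) / ((σ : ℂ) + (t : ℂ) * I) -
          Complex.exp (-(Real.pi : ℂ) * I / 4) *
            (((2 * Real.pi / (q : ℝ)) ^ ((q : ℝ) * σ - 1 / 2) : ℝ) : ℂ) *
            ((t ^ (-(1 / 2) - (q : ℝ) * σ) : ℝ) : ℂ) *
            ∑' n : ℕ,
              (((n + 1 : ℝ) ^ ((q : ℝ) * σ - 1) : ℝ) : ℂ) *
                (((2 * (n + 1 : ℝ) * Real.pi * Real.exp 1 / ((q : ℝ) * t) : ℝ) : ℂ) ^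
                  ((q : ℂ) * (t : ℂ) * I))‖ ≤
        C * t ^ (-(3 / 2) - (q : ℝ) * σ) := by
  have hq1 : (1 : ℝ) ≤ q := by exact_mod_cast hq
  have hq0 : (0 : ℝ) < q := by linarith
  set a : ℝ := 1 - q * σ with ha
  have hqσ : (q : ℝ) * σ < 0 := mul_neg_of_pos_of_neg hq0 hσ
  have ha1 : 1 < a := by rw [ha]; linarith
  obtain ⟨C, hC, hE⟩ := exists_functional_factor_eq ha1.le
  set Z : ℝ := ∑' n : ℕ, (n + 1 : ℝ) ^ ((q : ℝ) * σ - 1) with hZ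
  set c : ℝ := (2 * Real.pi / (q : ℝ)) ^ ((q : ℝ) * σ - 1 / 2) with hc
  have hc0 : 0 < c := by positivity
  refine ⟨c * Z * (C * |σ| + C + |σ|), fun t ht => ?_⟩
  have ht0 : 0 < t := by linarith
  have hT : 1 ≤ q * t := by nlinarith
  obtain ⟨E, hE1, hEeq⟩ := hE (q * t) hT
  set z : ℂ := (a : ℂ) - ((q * t : ℝ) : ℂ) * I with hz
  set s : ℂ := (σ : ℂ) + (t : ℂ) * I with hs
  have hqs : (q : ℂ) * s = 1 - z := by rw [hz, hs, ha]; push_cast; ring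
  have hzre : z.re = a := by simp [hz]
  have hs0 : s ≠ 0 := fun h => by
    have := congrArg im h
    simp [hs] at this
    linarith
  set S : ℂ := ∑' n : ℕ, (((n + 1 : ℝ) ^ ((q : ℝ) * σ - 1) : ℝ) : ℂ) *
    (((2 * (n + 1 : ℝ) * Real.pi * Real.exp 1 / ((q : ℝ) * t) : ℝ) : ℂ) ^
      ((q : ℂ) * (t : ℂ) * I)) with hS
  set M : ℂ := exp (-(Real.pi : ℂ) * I / 4) * (c : ℂ) *
    ((t ^ (-(1 / 2) - (q : ℝ) * σ) : ℝ) : ℂ) * S with hM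
  have hsum : Summable fun n : ℕ => (n + 1 : ℝ) ^ ((q : ℝ) * σ - 1) := by
    have := (summable_nat_add_iff 1).mpr
      (Real.summable_nat_rpow.mpr (by linarith : (q : ℝ) * σ - 1 < -1))
    simpa using this
  have hnorm : ∀ n : ℕ, ‖(((n + 1 : ℝ) ^ ((q : ℝ) * σ - 1) : ℝ) : ℂ) *
      (((2 * (n + 1 : ℝ) * Real.pi * Real.exp 1 / ((q : ℝ) * t) : ℝ) : ℂ) ^
      ((q : ℂ) * (t : ℂ) * I))‖ = (n + 1 : ℝ) ^ ((q : ℝ) * σ - 1) := by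
    intro n
    have hre : ((q : ℂ) * (t : ℂ) * I).re = 0 := by simp
    rw [norm_mul, norm_cpow_eq_rpow_re_of_pos (by positivity), hre, Real.rpow_zero, mul_one,
      norm_real, Real.norm_of_nonneg (by positivity)]
  have hSZ : ‖S‖ ≤ Z := by
    rw [hS, hZ]
    refine (norm_tsum_le_tsum_norm (by simpa only [hnorm] using hsum)).trans_eq ?_
    simp only [hnorm]
  have hMle : ‖M‖ ≤ c * Z * t ^ (-(1 / 2) - (q : ℝ) * σ) := by
    have h1 : ‖exp (-(Real.pi : ℂ) * I / 4)‖ = 1 := by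
      rw [norm_exp]; simp
    rw [hM, norm_mul, norm_mul, norm_mul, h1, norm_real, norm_real,
      Real.norm_of_nonneg hc0.le, Real.norm_of_nonneg (by positivity), one_mul, mul_right_comm]
    gcongr
  have hζ : riemannZeta z * exp ((Real.log (2 * Real.pi) - Real.log (q * t) + 1 : ℝ) *
      ((q * t : ℝ) * I)) = S := by
    rw [zeta_eq_tsum_one_div_nat_add_one_cpow (by rw [hzre]; exact ha1), ← tsum_mul_right, hS]
    refine tsum_congr fun n => ?_
    have hn : (0 : ℝ) < n + 1 := by positivity
    have hlog : Real.log (2 * (n + 1 : ℝ) * Real.pi * Real.exp 1 / ((q : ℝ) * t)) =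
        Real.log (n + 1) + Real.log (2 * Real.pi) - Real.log (q * t) + 1 := by
      rw [show 2 * (n + 1 : ℝ) * Real.pi * Real.exp 1 = (n + 1) * (2 * Real.pi) * Real.exp 1 by ring,
        Real.log_div (by positivity) (by positivity), Real.log_mul (by positivity) (by positivity),
        Real.log_mul (by positivity) (by positivity), Real.log_exp]
      ring
    have hnc : (n + 1 : ℂ) = ((n + 1 : ℝ) : ℂ) := by push_cast; rfl
    rw [hnc, ofReal_rpow_eq_exp hn, ofReal_cpow_eq_exp hn,
      ofReal_cpow_eq_exp (by positivity : 0 < 2 * (n + 1 : ℝ) * Real.pi * Real.exp 1 / (q * t)),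
      one_div, ← exp_neg, ← exp_add, ← exp_add, hlog, hz, ha]
    congr 1
    push_cast
    ring
  have hmain : riemannZeta ((q : ℂ) * s) / s = M * (E * (t * I / s)) := by
    have hz1 : z ≠ 1 := fun h => by
      have := congrArg re h
      rw [hzre, one_re] at this
      linarith
    have hzn : ∀ n : ℕ, z ≠ -n := fun n h => by
      have := congrArg re h
      rw [hzre, neg_re, natCast_re] at this
      linarith [(n.cast_nonneg : (0 : ℝ) ≤ n)]
    have hcr : (c : ℂ) = exp ((Real.log (2 * Real.pi) - Real.log q : ℝ) *
        ((q : ℝ) * σ - 1 / 2 : ℝ)) := by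
      rw [hc, ofReal_rpow_eq_exp (by positivity), Real.log_div (by positivity) hq0.ne']
    have htr : ((t ^ (-(1 / 2) - (q : ℝ) * σ) : ℝ) : ℂ) * (t * I) = exp ((Real.log t : ℝ) *
        (1 / 2 - (q : ℝ) * σ : ℝ) + Real.pi / 2 * I) := by
      have h1 : (t : ℂ) = exp (Real.log t : ℝ) := by rw [← ofReal_exp, Real.exp_log ht0]
      have h2 : I = exp (Real.pi / 2 * I) := by rw [exp_pi_div_two_mul_I]
      have h3 : (t * I : ℂ) = exp ((Real.log t : ℝ) + Real.pi / 2 * I) := by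
        rw [exp_add, ← h1, ← h2]
      rw [ofReal_rpow_eq_exp ht0, h3, ← exp_add]
      congr 1; push_cast; ring
    rw [hqs, riemannZeta_one_sub hzn hz1, hEeq, hM, ← hζ]
    have hexp : exp ((Real.log (2 * Real.pi) : ℝ) * (1 / 2 - z) +
        (Real.log (q * t) : ℝ) * (z - 1 / 2) + Real.pi / 4 * I + ((q * t : ℝ) : ℂ) * I) =
        exp (-(Real.pi : ℂ) * I / 4) * c *
        (((t ^ (-(1 / 2) - (q : ℝ) * σ) : ℝ) : ℂ) * (t * I)) *
        exp ((Real.log (2 * Real.pi) - Real.log (q * t) + 1 : ℝ) * ((q * t : ℝ) * I)) := by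
      rw [hcr, htr, ← exp_add, ← exp_add, ← exp_add, hz, ha, Real.log_mul hq0.ne' ht0.ne']
      congr 1
      push_cast
      ring
    rw [hexp]
    ring
  have hsdiv : ‖t * I / s - 1‖ ≤ |σ| / t := by
    have e : t * I / s - 1 = -σ / s := by
      field_simp; rw [hs]; ring
    have hst : t ≤ ‖s‖ := by
      have := abs_im_le_norm s
      simp only [hs, add_im, ofReal_im, mul_im, ofReal_re, I_im, mul_one, I_re, mul_zero,
        add_zero, zero_add] at this
      exact (le_abs_self t).trans this
    rw [e, norm_div, norm_neg, norm_real, Real.norm_eq_abs]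
    gcongr
  have hEt : ‖E - 1‖ ≤ C / t := hE1.trans (by gcongr; nlinarith)
  have hfin := norm_mul_sub_one_le ht hC (abs_nonneg σ) hEt hsdiv
  have hpow : t ^ (-(3 / 2) - (q : ℝ) * σ) = t ^ (-(1 / 2) - (q : ℝ) * σ) / t := by
    rw [← Real.rpow_sub_one ht0.ne']; congr 1; ring
  rw [hmain, ← mul_sub_one, norm_mul, hpow]
  calc _ ≤ c * Z * t ^ (-(1 / 2) - (q : ℝ) * σ) * ((C * |σ| + C + |σ|) / t) := by gcongr
    _ = _ := by ring
end

section
/- Let k ≥ 2 be an integer and p, q coprime integers with 1 ≤ p < q such that k is not a q-th power of an integer (so k^{p/q} is irrational and algebraic). For every ε > 0 there exists a constant C > 0 such that for all integers a and all integers N ≥ 0, |k^{p/q} − a/k^N| ≥ C k^{−(1+ε)N}. -/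
/-- The product of binomial coefficients `∏ j, (i j).choose (μ j)`. -/
def multichoose {σ : Type*} [Fintype σ] (i μ : σ → ℕ) : ℕ := ∏ j, (i j).choose (μ j)

theorem multichoose_add {σ : Type*} [Fintype σ] [DecidableEq σ] (i i' μ : σ → ℕ) :
    multichoose (i + i') μ =
      ∑ p ∈ Fintype.piFinset fun j => Finset.HasAntidiagonal.antidiagonal (μ j),
        multichoose i (fun j => (p j).1) * multichoose i' (fun j => (p j).2) := by
  simp only [multichoose, Pi.add_apply, Nat.add_choose_eq, Finset.prod_univ_sum,
    Finset.prod_mul_distrib]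

theorem Nat.choose_mul_choose_eq_sum (i a b : ℕ) :
    i.choose a * i.choose b =
      ∑ k ∈ Finset.range (b + 1), (a.choose (b - k) * (a + k).choose a) * i.choose (a + k) := by
  rcases lt_or_ge i a with h | h
  · rw [Nat.choose_eq_zero_of_lt h, zero_mul, Finset.sum_eq_zero]
    intro k _
    rw [Nat.choose_eq_zero_of_lt (by omega : i < a + k), mul_zero]
  · obtain ⟨c, rfl⟩ := Nat.exists_eq_add_of_le h
    conv_lhs => rw [add_comm a c, Nat.add_choose_eq c a b,
      Finset.Nat.sum_antidiagonal_eq_sum_range_succ_mk, Finset.mul_sum]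
    refine Finset.sum_congr rfl fun k _ => ?_
    have h1 := Nat.choose_mul (n := a + c) (k := a + k) (s := a) (Nat.le_add_right a k)
    simp only [Nat.add_sub_cancel_left] at h1
    rw [mul_assoc, mul_comm ((a + k).choose a), h1, add_comm c a]
    ring

theorem multichoose_mul_multichoose {σ : Type*} [Fintype σ] [DecidableEq σ] (a b : σ → ℕ) :
    ∃ (S : Finset (σ → ℕ)) (d : (σ → ℕ) → ℕ), (∀ ρ ∈ S, ρ ≤ a + b) ∧
      ∀ i : σ → ℕ, multichoose i a * multichoose i b = ∑ ρ ∈ S, d ρ * multichoose i ρ := by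
  refine ⟨(Fintype.piFinset fun j => Finset.range (b j + 1)).image fun k => a + k,
    fun ρ => ∏ j, ((a j).choose (b j - (ρ j - a j)) * (ρ j).choose (a j)), ?_, fun i => ?_⟩
  · simp only [Finset.mem_image, Fintype.mem_piFinset, Finset.mem_range]
    rintro _ ⟨k, hk, rfl⟩
    gcongr
    exact fun j => Nat.lt_succ_iff.mp (hk j)
  · rw [Finset.sum_image (by intro x _ y _ h; exact add_left_cancel h)]
    simp only [multichoose, ← Finset.prod_mul_distrib, Nat.choose_mul_choose_eq_sum,
      Finset.prod_univ_sum, Pi.add_apply, Nat.add_sub_cancel_left]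

theorem multichoose_le_two_pow {σ : Type*} [Fintype σ] (i μ : σ → ℕ) :
    multichoose i μ ≤ 2 ^ ∑ j, i j := by
  rw [multichoose, ← Finset.prod_pow_eq_pow_sum]
  exact Finset.prod_le_prod' fun j _ => Nat.choose_le_two_pow _ _

namespace MvPolynomial

open Finset

variable {σ : Type*} [Fintype σ] {R : Type*} [CommRing R]

/-- The diagonal operator multiplying the coefficient of `X ^ i` by `multichoose i μ`;
this is `X ^ μ` times the Hasse derivative of order `μ`. -/
noncomputable def hasse (μ : σ → ℕ) : MvPolynomial σ R →ₗ[R] MvPolynomial σ R :=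
  (basisMonomials σ R).constr R fun i => monomial i (multichoose i μ : R)

theorem hasse_monomial (μ : σ → ℕ) (i : σ →₀ ℕ) (c : R) :
    hasse μ (monomial i c) = monomial i (multichoose i μ * c) := by
  have h : monomial i c = c • basisMonomials σ R i := by
    simp [smul_monomial]
  rw [h, map_smul, hasse, Module.Basis.constr_basis, smul_monomial, smul_eq_mul, mul_comm]

theorem coeff_hasse (μ : σ → ℕ) (P : MvPolynomial σ R) (i : σ →₀ ℕ) :
    coeff i (hasse μ P) = multichoose i μ * coeff i P := by
  classical
  induction P using MvPolynomial.induction_on' with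
  | monomial u a =>
    rw [hasse_monomial, coeff_monomial, coeff_monomial]
    split_ifs with h
    · rw [h]
    · simp
  | add p q hp hq => simp [hp, hq, mul_add]

theorem map_hasse {S : Type*} [CommRing S] (φ : R →+* S) (μ : σ → ℕ) (P : MvPolynomial σ R) :
    map φ (hasse μ P) = hasse μ (map φ P) := by
  ext i
  simp [coeff_map, coeff_hasse]

theorem hasse_mul [DecidableEq σ] (μ : σ → ℕ) (P Q : MvPolynomial σ R) :
    hasse μ (P * Q) = ∑ p ∈ Fintype.piFinset fun j => HasAntidiagonal.antidiagonal (μ j),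
      hasse (fun j => (p j).1) P * hasse (fun j => (p j).2) Q := by
  induction P using MvPolynomial.induction_on' with
  | add P P' hP hP' => simp only [add_mul, map_add, hP, hP', sum_add_distrib]
  | monomial i c =>
    induction Q using MvPolynomial.induction_on' with
    | add Q Q' hQ hQ' => simp only [mul_add, map_add, hQ, hQ', sum_add_distrib]
    | monomial i' c' =>
      simp only [hasse_monomial, monomial_mul, Finsupp.coe_add, multichoose_add, ← map_sum]
      congr 1
      push_cast
      rw [sum_mul]
      exact sum_congr rfl fun p _ => by ring

theorem hasse_hasse [DecidableEq σ] (a b : σ → ℕ) :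
    ∃ (S : Finset (σ → ℕ)) (d : (σ → ℕ) → ℕ), (∀ ρ ∈ S, ρ ≤ a + b) ∧
      ∀ P : MvPolynomial σ R, hasse a (hasse b P) = ∑ ρ ∈ S, (d ρ : R) • hasse ρ P := by
  obtain ⟨S, d, hS, h⟩ := multichoose_mul_multichoose a b
  refine ⟨S, d, hS, fun P => ?_⟩
  ext i
  simp only [coeff_hasse, coeff_sum, coeff_smul, ← mul_assoc, smul_eq_mul, ← sum_mul]
  congr 1
  rw [← Nat.cast_mul, h]
  push_cast
  rfl

/-- All `hasse μ P` with `μ` of weight less than `θ` vanish at `x`. -/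
def VanishesTo (w : σ → ℝ) (x : σ → R) (θ : ℝ) (P : MvPolynomial σ R) : Prop :=
  ∀ μ : σ → ℕ, ∑ j, μ j * w j < θ → eval x (hasse μ P) = 0

theorem VanishesTo.mono {w : σ → ℝ} {x : σ → R} {θ θ' : ℝ} {P : MvPolynomial σ R}
    (h : VanishesTo w x θ P) (hθ : θ' ≤ θ) : VanishesTo w x θ' P :=
  fun μ hμ => h μ (hμ.trans_le hθ)

theorem VanishesTo.of_nonpos {w : σ → ℝ} {x : σ → R} {θ : ℝ} (hw : ∀ j, 0 ≤ w j) (hθ : θ ≤ 0)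
    (P : MvPolynomial σ R) : VanishesTo w x θ P := fun _ hμ =>
  absurd (hμ.trans_le hθ) (not_lt.mpr (sum_nonneg fun j _ => mul_nonneg (Nat.cast_nonneg _) (hw j)))

theorem VanishesTo.sum {w : σ → ℝ} {x : σ → R} {θ : ℝ} {ι : Type*} (s : Finset ι)
    (P : ι → MvPolynomial σ R) (h : ∀ i ∈ s, VanishesTo w x θ (P i)) :
    VanishesTo w x θ (∑ i ∈ s, P i) := fun μ hμ => by
  rw [map_sum, map_sum]
  exact sum_eq_zero fun i hi => h i hi μ hμ

theorem VanishesTo.smul {w : σ → ℝ} {x : σ → R} {θ : ℝ} (c : R)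
    {P : MvPolynomial σ R} (h : VanishesTo w x θ P) : VanishesTo w x θ (c • P) := fun μ hμ => by
  rw [map_smul, smul_eval, h μ hμ, mul_zero]

theorem VanishesTo.mul {w : σ → ℝ} {x : σ → R} {θ θ' : ℝ} {P Q : MvPolynomial σ R}
    (hP : VanishesTo w x θ P) (hQ : VanishesTo w x θ' Q) : VanishesTo w x (θ + θ') (P * Q) := by
  classical
  intro μ hμ
  rw [hasse_mul, map_sum]
  refine sum_eq_zero fun p hp => ?_
  rw [map_mul]
  simp only [Fintype.mem_piFinset, HasAntidiagonal.mem_antidiagonal] at hp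
  have h : ∑ j, ((p j).1 : ℝ) * w j + ∑ j, ((p j).2 : ℝ) * w j < θ + θ' := by
    rw [← sum_add_distrib]
    refine lt_of_eq_of_lt (sum_congr rfl fun j _ => ?_) hμ
    rw [← hp j]
    push_cast
    ring
  rcases lt_or_ge (∑ j, ((p j).1 : ℝ) * w j) θ with h1 | h1
  · rw [hP (fun j => (p j).1) h1, zero_mul]
  · rw [hQ (fun j => (p j).2) (by linarith), mul_zero]

theorem VanishesTo.prod {w : σ → ℝ} {x : σ → R} (hw : ∀ j, 0 ≤ w j) {ι : Type*} (s : Finset ι)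
    (θ : ι → ℝ) (P : ι → MvPolynomial σ R) (h : ∀ i ∈ s, VanishesTo w x (θ i) (P i)) :
    VanishesTo w x (∑ i ∈ s, θ i) (∏ i ∈ s, P i) := by
  classical
  induction s using Finset.induction_on with
  | empty => exact .of_nonpos hw (by simp) _
  | insert a s ha ih =>
    rw [sum_insert ha, prod_insert ha]
    exact (h a (mem_insert_self a s)).mul (ih fun i hi => h i (mem_insert_of_mem hi))

theorem VanishesTo.hasse {w : σ → ℝ} {x : σ → R} (hw : ∀ j, 0 ≤ w j) {θ : ℝ}
    {P : MvPolynomial σ R} (h : VanishesTo w x θ P) (b : σ → ℕ) :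
    VanishesTo w x (θ - ∑ j, b j * w j) (hasse b P) := by
  classical
  intro a ha
  obtain ⟨S, d, hS, h'⟩ := hasse_hasse (R := R) a b
  rw [h', map_sum]
  refine sum_eq_zero fun ρ hρ => ?_
  rw [smul_eval, h ρ, mul_zero]
  calc ∑ j, (ρ j : ℝ) * w j ≤ ∑ j, ((a j : ℝ) * w j + b j * w j) := by
        refine sum_le_sum fun j _ => ?_
        rw [← add_mul]
        exact mul_le_mul_of_nonneg_right (by exact_mod_cast hS ρ hρ j) (hw j)
    _ < θ := by rw [sum_add_distrib]; linarith

end MvPolynomial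

/-- Gaussian elimination with complete pivoting: a finitely supported matrix is a sum of rank one
matrices whose rows and columns have pairwise distinct leading positions. -/
theorem exists_pivot_decomposition {A B K : Type*} [LinearOrder A] [LinearOrder B] [Field K]
    (A₀ : Finset A) (B₀ : Finset B) (c : A → B → K) (hc : ∀ a b, c a b ≠ 0 → a ∈ A₀ ∧ b ∈ B₀) :
    ∃ (n : ℕ) (u : Fin n → A → K) (v : Fin n → B → K) (α : Fin n → A) (β : Fin n → B),
      α.Injective ∧ β.Injective ∧ (∀ j, u j (α j) ≠ 0) ∧ (∀ j, v j (β j) ≠ 0) ∧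
      (∀ j a, u j a ≠ 0 → a ∈ A₀ ∧ a ≤ α j) ∧ (∀ j b, v j b ≠ 0 → b ∈ B₀ ∧ b ≤ β j) ∧
      ∀ a b, c a b = ∑ j, u j a * v j b := by
  classical
  induction A₀ using Finset.induction_on_max generalizing B₀ c with
  | empty =>
    refine ⟨0, Fin.elim0, Fin.elim0, Fin.elim0, Fin.elim0, fun j => j.elim0, fun j => j.elim0,
      fun j => j.elim0, fun j => j.elim0, fun j => j.elim0, fun j => j.elim0, fun a b => ?_⟩
    by_contra h
    exact absurd (hc a b (by simpa using h)).1 (Finset.notMem_empty a)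
  | insert a₀ A₁ hmax ih =>
    by_cases hrow : ∀ b, c a₀ b = 0
    · obtain ⟨n, u, v, α, β, h1, h2, h3, h4, h5, h6, h7⟩ := ih B₀ c (fun a b hab => by
        refine ⟨(Finset.mem_insert.mp (hc a b hab).1).resolve_left ?_, (hc a b hab).2⟩
        rintro rfl
        exact hab (hrow b))
      exact ⟨n, u, v, α, β, h1, h2, h3, h4,
        fun j a h => ⟨Finset.mem_insert_of_mem (h5 j a h).1, (h5 j a h).2⟩, h6, h7⟩
    push Not at hrow
    obtain ⟨b₀, hb₀, hb₀max⟩ : ∃ b₀, c a₀ b₀ ≠ 0 ∧ ∀ b, c a₀ b ≠ 0 → b ≤ b₀ := by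
      obtain ⟨b, hb⟩ := hrow
      have hne : (B₀.filter fun b => c a₀ b ≠ 0).Nonempty :=
        ⟨b, Finset.mem_filter.mpr ⟨(hc a₀ b hb).2, hb⟩⟩
      exact ⟨_, (Finset.mem_filter.mp (Finset.max'_mem _ hne)).2, fun b hb =>
        Finset.le_max' (B₀.filter fun b => c a₀ b ≠ 0) b
          (Finset.mem_filter.mpr ⟨(hc a₀ b hb).2, hb⟩)⟩
    have hB₀ : b₀ ∈ B₀ := (hc a₀ b₀ hb₀).2
    obtain ⟨n, u, v, α, β, h1, h2, h3, h4, h5, h6, h7⟩ :=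
      ih (B₀.erase b₀) (fun a b => c a b - c a b₀ * (c a₀ b / c a₀ b₀)) (fun a b hab => by
        have hb : b ≠ b₀ := by
          rintro rfl
          exact hab (by simp [div_self hb₀])
        have ha : a ≠ a₀ := by
          rintro rfl
          exact hab (by field_simp; ring)
        have : c a b ≠ 0 ∨ (c a b₀ ≠ 0 ∧ c a₀ b ≠ 0) := by
          by_contra! h
          apply hab
          by_cases h' : c a b₀ = 0
          · simp [h.1, h']
          · simp [h.1, h.2 h']
        rw [Finset.mem_erase]
        rcases this with h | ⟨h, h'⟩
        · exact ⟨(Finset.mem_insert.mp (hc _ _ h).1).resolve_left ha, hb, (hc _ _ h).2⟩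
        · exact ⟨(Finset.mem_insert.mp (hc _ _ h).1).resolve_left ha, hb, (hc _ _ h').2⟩)
    have hα : ∀ j, α j ∈ A₁ := fun j => (h5 j _ (h3 j)).1
    have hβ : ∀ j, β j ≠ b₀ := fun j => (Finset.mem_erase.mp (h6 j _ (h4 j)).1).1
    refine ⟨n + 1, Fin.cons (fun a => c a b₀) u, Fin.cons (fun b => c a₀ b / c a₀ b₀) v,
      Fin.cons a₀ α, Fin.cons b₀ β, ?_, ?_, ?_, ?_, ?_, ?_, ?_⟩
    · refine Fin.cons_injective_iff.mpr ⟨?_, h1⟩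
      rintro ⟨j, hj⟩
      exact (hmax _ (hα j)).ne hj
    · refine Fin.cons_injective_iff.mpr ⟨?_, h2⟩
      rintro ⟨j, hj⟩
      exact hβ j hj
    · exact Fin.cases hb₀ h3
    · exact Fin.cases (by simpa using hb₀) h4
    · refine Fin.cases (fun a ha => ?_) fun j a ha => ?_
      · have h := (hc a b₀ ha).1
        refine ⟨h, ?_⟩
        rcases Finset.mem_insert.mp h with h | h
        · exact h.le
        · exact (hmax a h).le
      · exact ⟨Finset.mem_insert_of_mem (h5 j a ha).1, (h5 j a ha).2⟩
    · refine Fin.cases (fun b hb => ?_) fun j b hb => ?_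
      · have h : c a₀ b ≠ 0 := fun h => hb (by simp [h])
        exact ⟨(hc a₀ b h).2, hb₀max b h⟩
      · exact ⟨Finset.mem_of_mem_erase (h6 j b hb).1, (h6 j b hb).2⟩
    · intro a b
      rw [Fin.sum_univ_succ]
      simp only [Fin.cons_zero, Fin.cons_succ, ← h7]
      ring

section Interpolation

variable {σ : Type*} [Fintype σ]

theorem mul_mem_span_multichoose [DecidableEq σ] {ι : Type*} (α : ι → σ → ℕ) (d : ℕ) (l : σ) (t : ℚ)
    (v : ι → ℚ) (hv : v ∈ Submodule.span ℚ
      ((fun μ j => (multichoose (α j) μ : ℚ)) '' {μ : σ → ℕ | ∑ l, μ l ≤ d})) :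
    (fun j => ((α j l : ℚ) - t) * v j) ∈ Submodule.span ℚ
      ((fun μ j => (multichoose (α j) μ : ℚ)) '' {μ : σ → ℕ | ∑ l, μ l ≤ d + 1}) := by
  induction hv using Submodule.span_induction with
  | zero => simp only [Pi.zero_apply, mul_zero]; exact zero_mem _
  | add x y _ _ hx hy =>
    simp only [Pi.add_apply, mul_add]
    exact add_mem hx hy
  | smul a x _ hx =>
    have := Submodule.smul_mem _ a hx
    convert this using 1
    ext j
    simp only [Pi.smul_apply, smul_eq_mul]
    ring
  | mem x hx =>
    obtain ⟨μ, hμ, rfl⟩ := hx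
    rw [Set.mem_ofPred_eq] at hμ
    have h1 : (fun j => (multichoose (α j) (μ + Pi.single l 1) : ℚ)) ∈ Submodule.span ℚ
      ((fun μ j => (multichoose (α j) μ : ℚ)) '' {μ : σ → ℕ | ∑ l, μ l ≤ d + 1}) := by
      refine Submodule.subset_span ⟨_, ?_, rfl⟩
      simp only [Set.mem_ofPred_eq, Pi.add_apply, Finset.sum_add_distrib, Finset.sum_pi_single',
        Finset.mem_univ, if_true]
      omega
    have h2 : (fun j => (multichoose (α j) μ : ℚ)) ∈ Submodule.span ℚ
      ((fun μ j => (multichoose (α j) μ : ℚ)) '' {μ : σ → ℕ | ∑ l, μ l ≤ d + 1}) :=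
      Submodule.subset_span ⟨_, Nat.le_succ_of_le hμ, rfl⟩
    convert add_mem (Submodule.smul_mem _ ((μ l : ℚ) + 1) h1)
      (Submodule.smul_mem _ ((μ l : ℚ) - t) h2) using 1
    ext j
    simp only [Pi.add_apply, Pi.smul_apply, smul_eq_mul, multichoose]
    rw [← Finset.mul_prod_erase Finset.univ
        (fun x => (α j x).choose (μ x + (Pi.single l 1 : σ → ℕ) x)) (Finset.mem_univ l),
      ← Finset.mul_prod_erase Finset.univ (fun l => (α j l).choose (μ l)) (Finset.mem_univ l)]
    have : ∏ x ∈ Finset.univ.erase l, (α j x).choose (μ x + (Pi.single l 1 : σ → ℕ) x) =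
        ∏ x ∈ Finset.univ.erase l, (α j x).choose (μ x) :=
      Finset.prod_congr rfl fun x hx => by simp [Finset.ne_of_mem_erase hx]
    rw [this]
    simp only [Pi.single_eq_same]
    have h3 : ((α j l).choose (μ l + 1) : ℚ) * (μ l + 1) =
        (α j l).choose (μ l) * (α j l - μ l) := by
      rcases le_or_gt (μ l) (α j l) with h | h
      · rw [← Nat.cast_sub h]
        exact_mod_cast Nat.choose_succ_right_eq _ _
      · rw [Nat.choose_eq_zero_of_lt h, Nat.choose_eq_zero_of_lt (h.trans (Nat.lt_succ_self _))]
        simp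
    push_cast
    linear_combination
      (-∏ x ∈ Finset.univ.erase l, ((α j x).choose (μ x) : ℚ)) * h3

theorem exists_mem_span_multichoose [DecidableEq σ] {ι : Type*} [DecidableEq ι] (α : ι → σ → ℕ)
    (hα : α.Injective) (j₀ : ι) (J : Finset ι) (hJ : j₀ ∉ J) :
    ∃ v ∈ Submodule.span ℚ
      ((fun μ j => (multichoose (α j) μ : ℚ)) '' {μ : σ → ℕ | ∑ l, μ l ≤ J.card}),
      v j₀ ≠ 0 ∧ ∀ j ∈ J, v j = 0 := by
  induction J using Finset.induction_on with
  | empty =>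
    refine ⟨fun _ => 1, Submodule.subset_span ⟨0, by simp, ?_⟩, one_ne_zero, by simp⟩
    ext j
    simp [multichoose]
  | insert j J hj ih =>
    rw [Finset.mem_insert, not_or] at hJ
    obtain ⟨v, hv, hv₀, hvJ⟩ := ih hJ.2
    obtain ⟨l, hl⟩ := Function.ne_iff.mp (hα.ne hJ.1)
    rw [Finset.card_insert_of_notMem hj]
    refine ⟨_, mul_mem_span_multichoose α _ l (α j l) v hv, ?_, fun j' hj' => ?_⟩
    · exact mul_ne_zero (sub_ne_zero.mpr (by exact_mod_cast hl)) hv₀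
    · rcases Finset.mem_insert.mp hj' with rfl | hJ₂
      · simp
      · simp [hvJ _ hJ₂]

/-- Distinct points `α j` of `ℕ ^ σ` are separated by multivariate binomial coefficients of order
less than the number of points. -/
theorem exists_det_multichoose_ne_zero {n : ℕ} (α : Fin n → σ → ℕ)
    (hα : α.Injective) : ∃ μ : Fin n → σ → ℕ, (∀ a, ∑ l, μ a l + 1 ≤ n) ∧
      (Matrix.of fun a j => (multichoose (α j) (μ a) : ℚ)).det ≠ 0 := by
  classical
  set T := (fun (μ : σ → ℕ) (j : Fin n) => (multichoose (α j) μ : ℚ)) ''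
    {μ : σ → ℕ | ∑ l, μ l ≤ n - 1} with hT
  have htop : Submodule.span ℚ T = ⊤ := by
    rw [eq_top_iff, ← (Pi.basisFun ℚ (Fin n)).span_eq, Submodule.span_le]
    rintro _ ⟨j₀, rfl⟩
    obtain ⟨v, hv, hv₀, hvJ⟩ := exists_mem_span_multichoose α hα j₀ (Finset.univ.erase j₀)
      (Finset.notMem_erase _ _)
    rw [Finset.card_erase_of_mem (Finset.mem_univ _), Finset.card_univ, Fintype.card_fin] at hv
    have hsmul := Submodule.smul_mem _ (v j₀)⁻¹ hv
    rw [← hT] at hsmul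
    suffices heq : (v j₀)⁻¹ • v = Pi.basisFun ℚ (Fin n) j₀ by
      exact heq ▸ hsmul
    ext j
    by_cases h : j = j₀
    · subst h
      simp [hv₀]
    · simp [h, hvJ j (Finset.mem_erase.mpr ⟨h, Finset.mem_univ _⟩)]
  obtain ⟨f, hfT, -, hf⟩ := Submodule.exists_fun_fin_finrank_span_eq ℚ T
  have hn : Module.finrank ℚ (Submodule.span ℚ T) = n := by
    rw [htop, finrank_top, Module.finrank_fin_fun]
  choose μ hμ hμf using hfT
  refine ⟨fun a => μ (Fin.cast hn.symm a), fun a => ?_, ?_⟩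
  · have h1 := hμ (Fin.cast hn.symm a)
    have h2 := a.pos
    rw [Set.mem_ofPred_eq] at h1
    change ∑ l, μ (Fin.cast hn.symm a) l + 1 ≤ n
    omega
  · rw [← isUnit_iff_ne_zero, ← Matrix.isUnit_iff_isUnit_det,
      ← Matrix.linearIndependent_rows_iff_isUnit]
    have heq : (Matrix.of fun a j => (multichoose (α j) (μ (Fin.cast hn.symm a)) : ℚ)).row =
        f ∘ Fin.cast hn.symm := by
      ext a j
      simp only [Function.comp_apply, ← hμf]
      rfl
    rw [heq]
    exact hf.comp (Fin.cast hn.symm) (Fin.cast_injective _)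

end Interpolation

namespace MvPolynomial

open Finset

theorem coeff_prod_of_degree_le {σ R ι : Type*} [CommSemiring R] (m : MonomialOrder σ)
    (s : Finset ι) (f : ι → MvPolynomial σ R) (α : ι → σ →₀ ℕ)
    (h : ∀ j ∈ s, m.toSyn (m.degree (f j)) ≤ m.toSyn (α j)) :
    coeff (∑ j ∈ s, α j) (∏ j ∈ s, f j) = ∏ j ∈ s, coeff (α j) (f j) ∧
      m.toSyn (m.degree (∏ j ∈ s, f j)) ≤ m.toSyn (∑ j ∈ s, α j) := by
  classical
  induction s using Finset.induction_on with
  | empty => simp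
  | insert a s ha ih =>
    obtain ⟨h1, h2⟩ := ih fun j hj => h j (mem_insert_of_mem hj)
    have h3 := h a (mem_insert_self a s)
    rw [sum_insert ha, prod_insert ha, prod_insert ha]
    refine ⟨?_, ?_⟩
    · rw [m.coeff_mul_of_add_of_degree_le h3 h2, h1]
    · refine m.degree_mul_le.trans ?_
      rw [map_add, map_add]
      exact add_le_add h3 h2

/-- A generalised Wronskian criterion. -/
theorem exists_det_hasse_ne_zero {σ : Type*} [Fintype σ] (m : MonomialOrder σ) {n : ℕ}
    (f : Fin n → MvPolynomial σ ℚ) (α : Fin n → σ →₀ ℕ) (hα : α.Injective)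
    (hf : ∀ j, coeff (α j) (f j) ≠ 0)
    (hle : ∀ j i, coeff i (f j) ≠ 0 → m.toSyn i ≤ m.toSyn (α j)) :
    ∃ μ : Fin n → σ → ℕ, (∀ a, ∑ l, μ a l + 1 ≤ n) ∧
      (Matrix.of fun a j => hasse (μ a) (f j)).det ≠ 0 := by
  obtain ⟨μ, hμ, hdet⟩ := exists_det_multichoose_ne_zero (fun j => ⇑(α j))
    (DFunLike.coe_injective.comp hα)
  refine ⟨μ, hμ, fun h => ?_⟩
  have hcoeff : coeff (∑ j, α j) (Matrix.of fun a j => hasse (μ a) (f j)).det =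
      (∏ j, coeff (α j) (f j)) *
        (Matrix.of fun a j => (multichoose (α j) (μ a) : ℚ)).det := by
    rw [Matrix.det_apply', Matrix.det_apply', coeff_sum, mul_sum]
    refine sum_congr rfl fun π _ => ?_
    rw [← map_intCast (C (σ := σ) (R := ℚ)), coeff_C_mul]
    simp only [Matrix.of_apply]
    rw [(coeff_prod_of_degree_le m univ (fun j => hasse (μ (π j)) (f j)) α ?_).1]
    · simp only [coeff_hasse, prod_mul_distrib]
      ring
    · intro j _
      rw [m.degree_le_iff]
      intro i hi
      rw [mem_support_iff, coeff_hasse] at hi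
      exact hle j i (right_ne_zero_of_mul hi)
  rw [h, coeff_zero] at hcoeff
  exact mul_ne_zero (prod_ne_zero_iff.mpr fun j _ => hf j) hdet hcoeff.symm

/-- The product of a polynomial in the variables `1, …, m` and one in the variable `0`. -/
noncomputable def tensor {R : Type*} [CommRing R] {m : ℕ} (f : MvPolynomial (Fin m) R)
    (g : MvPolynomial (Fin 1) R) : MvPolynomial (Fin (m + 1)) R :=
  rename Fin.succ f * rename (fun _ => 0) g

section tensor

variable {R : Type*} [CommRing R] {m : ℕ} (f : MvPolynomial (Fin m) R) (g : MvPolynomial (Fin 1) R)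

theorem coeff_tensor (i : Fin (m + 1) →₀ ℕ) :
    coeff i (tensor f g) = coeff i.tail f * coeff (Finsupp.single 0 (i 0)) g := by
  classical
  have hmon : ∀ a c b c', coeff i (tensor (monomial a c : MvPolynomial (Fin m) R) (monomial b c')) =
      coeff i.tail (monomial a c : MvPolynomial (Fin m) R) *
        coeff (Finsupp.single 0 (i 0)) (monomial b c') := by
    intro a c b c'
    have hab : Finsupp.mapDomain Fin.succ a + Finsupp.mapDomain (fun _ => 0) b =
        Finsupp.cons (b 0) a := by
      refine Finsupp.ext fun j => ?_
      refine Fin.cases ?_ (fun j => ?_) j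
      · rw [Finsupp.add_apply, Finsupp.mapDomain_of_notMem_range, Finsupp.cons_zero, zero_add]
        · have : b = Finsupp.single 0 (b 0) := by
            refine Finsupp.ext fun j => ?_
            rw [Subsingleton.elim j 0, Finsupp.single_eq_same]
          rw [this, Finsupp.mapDomain_single]
          simp
        · rintro ⟨j, hj⟩
          exact Fin.succ_ne_zero j hj
      · rw [Finsupp.add_apply, Finsupp.mapDomain_apply (Fin.succ_injective _), Finsupp.cons_succ,
          Finsupp.mapDomain_of_notMem_range, add_zero]
        rintro ⟨_, hj⟩
        exact Fin.succ_ne_zero j hj.symm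
    rw [tensor, rename_monomial, rename_monomial, monomial_mul, hab, coeff_monomial, coeff_monomial,
      coeff_monomial]
    have h1 : Finsupp.cons (b 0) a = i ↔ a = i.tail ∧ b = Finsupp.single 0 (i 0) := by
      constructor
      · rintro rfl
        refine ⟨(Finsupp.tail_cons _ _).symm, ?_⟩
        refine Finsupp.ext fun j => ?_
        rw [Subsingleton.elim j 0, Finsupp.single_eq_same, Finsupp.cons_zero]
      · rintro ⟨rfl, rfl⟩
        rw [Finsupp.single_eq_same, Finsupp.cons_tail]
    simp only [h1]
    split_ifs <;> simp_all
  induction f using MvPolynomial.induction_on' with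
  | add p q hp hq => 
    have : tensor (p + q) g = tensor p g + tensor q g := by simp [tensor, add_mul]
    rw [this, coeff_add, hp, hq, coeff_add, add_mul]
  | monomial a c =>
    induction g using MvPolynomial.induction_on' with
    | add p q hp hq =>
      have : tensor (monomial a c) (p + q) = tensor (monomial a c) p + tensor (monomial a c) q := by
        simp [tensor, mul_add]
      rw [this, coeff_add, hp, hq, coeff_add, mul_add]
    | monomial b c' => exact hmon a c b c'

theorem hasse_tensor (ν : ℕ) (μ : Fin m → ℕ) :
    hasse (Fin.cons ν μ) (tensor f g) = tensor (hasse μ f) (hasse (fun _ => ν) g) := by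
  ext i
  have : multichoose i (Fin.cons ν μ : Fin (m + 1) → ℕ) =
      multichoose i.tail μ * multichoose (Finsupp.single (0 : Fin 1) (i 0)) (fun _ => ν) := by
    simp [multichoose, Fin.prod_univ_succ, mul_comm, Finsupp.tail_apply]
  simp only [coeff_hasse, coeff_tensor, this]
  push_cast
  ring

theorem eval_tensor (x : Fin (m + 1) → R) :
    eval x (tensor f g) = eval (fun j => x j.succ) f * eval (fun _ => x 0) g := by
  rw [tensor, map_mul, eval_rename, eval_rename]
  rfl

theorem tensor_det {n : ℕ} (M : Matrix (Fin n) (Fin n) (MvPolynomial (Fin m) R))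
    (N : Matrix (Fin n) (Fin n) (MvPolynomial (Fin 1) R)) :
    tensor M.det N.det = (Matrix.of fun a b => ∑ j, tensor (M a j) (N j b)).det := by
  rw [tensor, AlgHom.map_det, AlgHom.map_det, ← Matrix.det_mul]
  rfl

end tensor

theorem exists_tensor_decomposition {m : ℕ} (P : MvPolynomial (Fin (m + 1)) ℚ) :
    ∃ (n : ℕ) (f : Fin n → MvPolynomial (Fin m) ℚ) (g : Fin n → MvPolynomial (Fin 1) ℚ)
      (α : Fin n → Fin m →₀ ℕ) (β : Fin n → Fin 1 →₀ ℕ), α.Injective ∧ β.Injective ∧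
      (∀ j, coeff (α j) (f j) ≠ 0) ∧ (∀ j, coeff (β j) (g j) ≠ 0) ∧
      (∀ j i, coeff i (f j) ≠ 0 →
        MonomialOrder.lex.toSyn i ≤ MonomialOrder.lex.toSyn (α j)) ∧
      (∀ j i, coeff i (g j) ≠ 0 →
        MonomialOrder.lex.toSyn i ≤ MonomialOrder.lex.toSyn (β j)) ∧
      (∀ j, ∃ i ∈ P.support, β j 0 = i 0) ∧
      P = ∑ j, tensor (f j) (g j) := by
  classical
  set e := (MonomialOrder.lex (σ := Fin m)).toSyn
  set e' := (MonomialOrder.lex (σ := Fin 1)).toSyn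
  obtain ⟨n, u, v, α, β, h1, h2, h3, h4, h5, h6, h7⟩ := exists_pivot_decomposition
    (P.support.image fun i => e i.tail) (P.support.image fun i => e' (Finsupp.single 0 (i 0)))
    (fun a b => coeff (Finsupp.cons (e'.symm b 0) (e.symm a)) P) (fun a b hab => by
      rw [← mem_support_iff] at hab
      simp only [mem_image]
      refine ⟨⟨_, hab, by simp⟩, ⟨_, hab, ?_⟩⟩
      rw [Finsupp.cons_zero, ← AddEquiv.eq_symm_apply]
      refine Finsupp.ext fun j => ?_
      rw [Subsingleton.elim j 0, Finsupp.single_eq_same])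
  have hsingle : ∀ b : Fin 1 →₀ ℕ, Finsupp.single 0 (b 0) = b := by
    intro b
    refine Finsupp.ext fun j => ?_
    rw [Subsingleton.elim j 0, Finsupp.single_eq_same]
  have hu : ∀ j i, coeff i (∑ a ∈ P.support.image fun i => i.tail,
      monomial a (u j (e a))) = u j (e i) := by
    intro j i
    simp only [coeff_sum, coeff_monomial, sum_ite_eq']
    split_ifs with h
    · rfl
    · by_contra h'
      have := (h5 j _ (Ne.symm h')).1
      simp only [mem_image, EmbeddingLike.apply_eq_iff_eq] at this h
      exact h this
  have hv : ∀ j i, coeff i (∑ a ∈ P.support.image fun i => Finsupp.single 0 (i 0),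
      monomial a (v j (e' a))) = v j (e' i) := by
    intro j i
    simp only [coeff_sum, coeff_monomial, sum_ite_eq']
    split_ifs with h
    · rfl
    · by_contra h'
      have := (h6 j _ (Ne.symm h')).1
      simp only [mem_image, EmbeddingLike.apply_eq_iff_eq] at this h
      exact h this
  refine ⟨n, fun j => ∑ a ∈ P.support.image fun i => i.tail, monomial a (u j (e a)),
    fun j => ∑ a ∈ P.support.image fun i => Finsupp.single 0 (i 0), monomial a (v j (e' a)),
    fun j => e.symm (α j), fun j => e'.symm (β j), e.symm.injective.comp h1,
    e'.symm.injective.comp h2, ?_, ?_, ?_, ?_, ?_, ?_⟩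
  · intro j
    rw [hu, AddEquiv.apply_symm_apply]
    exact h3 j
  · intro j
    rw [hv, AddEquiv.apply_symm_apply]
    exact h4 j
  · intro j i
    rw [hu, AddEquiv.apply_symm_apply]
    exact fun h => (h5 j _ h).2
  · intro j i
    rw [hv, AddEquiv.apply_symm_apply]
    exact fun h => (h6 j _ h).2
  · intro j
    obtain ⟨i, hi, hij⟩ := mem_image.mp (h6 j _ (h4 j)).1
    refine ⟨i, hi, ?_⟩
    change e'.symm (β j) 0 = i 0
    rw [← hij, AddEquiv.symm_apply_apply, Finsupp.single_eq_same]
  · ext i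
    simp only [coeff_sum, coeff_tensor, hu, hv]
    rw [← h7, AddEquiv.symm_apply_apply, AddEquiv.symm_apply_apply, Finsupp.single_eq_same,
      Finsupp.cons_tail]

/-- A determinant of derivatives of `P` that splits off the variable `0`. -/
theorem exists_det_hasse_eq_tensor {m : ℕ} (P : MvPolynomial (Fin (m + 1)) ℚ) (hP : P ≠ 0)
    {r : ℕ} (hr : ∀ i ∈ P.support, i 0 ≤ r) :
    ∃ (n : ℕ) (ν : Fin n → ℕ) (μ : Fin n → Fin m → ℕ) (U : MvPolynomial (Fin m) ℚ)
      (V : MvPolynomial (Fin 1) ℚ), 0 < n ∧ n ≤ r + 1 ∧ ν.Injective ∧ (∀ b, ν b + 1 ≤ n) ∧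
      (∀ a, ∑ l, μ a l + 1 ≤ n) ∧ U ≠ 0 ∧ V ≠ 0 ∧
      (Matrix.of fun a b => hasse (Fin.cons (ν b) (μ a)) P).det = tensor U V := by
  obtain ⟨n, f, g, α, β, h1, h2, h3, h4, h5, h6, h7, h8⟩ := exists_tensor_decomposition P
  obtain ⟨μ, hμ, hU⟩ := exists_det_hasse_ne_zero _ f α h1 h3 h5
  obtain ⟨ν, hν, hV⟩ := exists_det_hasse_ne_zero _ g β h2 h4 h6
  have hconst : ∀ b, ν b = fun _ => ν b 0 := fun b => by
    ext j
    rw [Subsingleton.elim j 0]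
  refine ⟨n, fun b => ν b 0, μ, (Matrix.of fun a j => hasse (μ a) (f j)).det,
    (Matrix.of fun a j => hasse (ν a) (g j)).transpose.det, ?_, ?_, ?_, ?_, hμ, hU, ?_, ?_⟩
  · refine Nat.pos_of_ne_zero ?_
    rintro rfl
    exact hP (by rw [h8]; simp)
  · have hinj : Function.Injective fun j => (⟨β j 0, by
        obtain ⟨i, hi, hij⟩ := h7 j
        rw [hij]
        exact Nat.lt_succ_of_le (hr i hi)⟩ : Fin (r + 1)) := by
      intro j j' h
      refine h2 (Finsupp.ext fun l => ?_)
      rw [Subsingleton.elim l 0]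
      exact Fin.mk.inj_iff.mp h
    simpa using Fintype.card_le_of_injective _ hinj
  · intro b b' hbb
    by_contra hne
    refine hV (Matrix.det_zero_of_row_eq hne ?_)
    ext1 j
    simp only [Matrix.of_apply]
    rw [hconst b, hconst b']
    simp only at hbb
    rw [hbb]
  · intro b
    simpa using hν b
  · rwa [Matrix.det_transpose]
  · rw [tensor_det]
    congr 1
    ext1 a b
    simp only [Matrix.of_apply, Matrix.transpose_apply]
    conv_lhs => rw [h8]
    rw [map_sum]
    refine sum_congr rfl fun j _ => ?_
    rw [hasse_tensor, ← hconst b]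

end MvPolynomial

namespace MvPolynomial

open Finset

section l1

variable {σ : Type*}

/-- The sum of the absolute values of the coefficients. -/
noncomputable def l1 (P : MvPolynomial σ ℤ) : ℕ := ∑ i ∈ P.support, (coeff i P).natAbs

theorem l1_eq_sum {P : MvPolynomial σ ℤ} {s : Finset (σ →₀ ℕ)} (h : P.support ⊆ s) :
    l1 P = ∑ i ∈ s, (coeff i P).natAbs :=
  sum_subset h fun i _ hi => by rw [notMem_support_iff.mp hi, Int.natAbs_zero]

theorem l1_zero : l1 (0 : MvPolynomial σ ℤ) = 0 := by simp [l1]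

theorem l1_add_le (P Q : MvPolynomial σ ℤ) : l1 (P + Q) ≤ l1 P + l1 Q := by
  classical
  rw [l1_eq_sum (support_add (p := P) (q := Q)), l1_eq_sum (subset_union_left (s₂ := Q.support)),
    l1_eq_sum (subset_union_right (s₁ := P.support) (s₂ := Q.support)), ← sum_add_distrib]
  exact sum_le_sum fun i _ => by rw [coeff_add]; exact Int.natAbs_add_le _ _

theorem l1_sum_le {ι : Type*} (s : Finset ι) (f : ι → MvPolynomial σ ℤ) :
    l1 (∑ j ∈ s, f j) ≤ ∑ j ∈ s, l1 (f j) :=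
  le_sum_of_subadditive l1 l1_zero.le l1_add_le s f

theorem l1_monomial (i : σ →₀ ℕ) (c : ℤ) : l1 (monomial i c) = c.natAbs := by
  classical
  rw [l1_eq_sum (support_monomial_subset), sum_singleton, coeff_monomial, if_pos rfl]

theorem l1_smul (c : ℤ) (P : MvPolynomial σ ℤ) : l1 (c • P) = c.natAbs * l1 P := by
  rw [l1_eq_sum (support_smul), l1, mul_sum]
  exact sum_congr rfl fun i _ => by rw [coeff_smul, smul_eq_mul, Int.natAbs_mul]

theorem l1_mul_le (P Q : MvPolynomial σ ℤ) : l1 (P * Q) ≤ l1 P * l1 Q := by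
  conv_lhs => rw [P.as_sum, Q.as_sum, sum_mul_sum]
  refine (l1_sum_le _ _).trans ?_
  rw [l1, l1, sum_mul_sum]
  refine sum_le_sum fun i _ => (l1_sum_le _ _).trans (sum_le_sum fun j _ => ?_)
  rw [monomial_mul, l1_monomial, Int.natAbs_mul]

theorem l1_prod_le {ι : Type*} (s : Finset ι) (f : ι → MvPolynomial σ ℤ) :
    l1 (∏ j ∈ s, f j) ≤ ∏ j ∈ s, l1 (f j) := by
  classical
  induction s using Finset.induction_on with
  | empty => rw [prod_empty, prod_empty, ← C_1, C_apply, l1_monomial, Int.natAbs_one]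
  | insert a s ha ih =>
    rw [prod_insert ha, prod_insert ha]
    exact (l1_mul_le _ _).trans (Nat.mul_le_mul_left _ ih)

theorem l1_det_le {n B : ℕ} (M : Matrix (Fin n) (Fin n) (MvPolynomial σ ℤ))
    (hM : ∀ a b, l1 (M a b) ≤ B) : l1 M.det ≤ n.factorial * B ^ n := by
  rw [Matrix.det_apply]
  refine (l1_sum_le _ _).trans ((sum_le_card_nsmul _ _ (B ^ n) fun π _ => ?_).trans ?_)
  · rw [Units.smul_def, l1_smul, Int.units_natAbs, one_mul]
    refine (l1_prod_le _ _).trans ((prod_le_prod' fun b _ => hM (π b) b).trans ?_)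
    simp
  · rw [card_univ, Fintype.card_perm, Fintype.card_fin, smul_eq_mul]

theorem natAbs_coeff_le_l1 (P : MvPolynomial σ ℤ) (i : σ →₀ ℕ) : (coeff i P).natAbs ≤ l1 P := by
  classical
  rw [l1_eq_sum (subset_insert i P.support)]
  exact single_le_sum (f := fun i => (coeff i P).natAbs) (fun _ _ => Nat.zero_le _)
    (mem_insert_self _ _)

theorem one_le_l1 {P : MvPolynomial σ ℤ} (hP : P ≠ 0) : 1 ≤ l1 P := by
  obtain ⟨i, hi⟩ := ne_zero_iff.mp hP
  exact (Int.natAbs_pos.mpr hi).trans_le (natAbs_coeff_le_l1 P i)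

theorem support_hasse_subset [Fintype σ] {R : Type*} [CommRing R] (μ : σ → ℕ)
    (P : MvPolynomial σ R) : (hasse μ P).support ⊆ P.support := fun i hi => by
  rw [mem_support_iff, coeff_hasse] at hi
  exact mem_support_iff.mpr (right_ne_zero_of_mul hi)

theorem l1_hasse_le [Fintype σ] (μ : σ → ℕ) (P : MvPolynomial σ ℤ) (r : σ → ℕ)
    (hr : ∀ j, P.degreeOf j ≤ r j) : l1 (hasse μ P) ≤ 2 ^ (∑ j, r j) * l1 P := by
  rw [l1_eq_sum (support_hasse_subset μ P), l1, mul_sum]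
  refine sum_le_sum fun i hi => ?_
  rw [coeff_hasse, Int.natAbs_mul, Int.natAbs_natCast]
  refine Nat.mul_le_mul_right _ ((multichoose_le_two_pow _ _).trans ?_)
  exact Nat.pow_le_pow_right two_pos (sum_le_sum fun j _ => degreeOf_le_iff.mp (hr j) i hi)

theorem degreeOf_det_le {R : Type*} [CommRing R] {n : ℕ} (j : σ) (r : ℕ)
    (M : Matrix (Fin n) (Fin n) (MvPolynomial σ R)) (hM : ∀ a b, (M a b).degreeOf j ≤ r) :
    M.det.degreeOf j ≤ n * r := by
  rw [Matrix.det_apply']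
  refine (degreeOf_sum_le _ _ _).trans (Finset.sup_le fun π _ => ?_)
  rw [← map_intCast (C (σ := σ) (R := R))]
  refine (degreeOf_C_mul_le _ _ _).trans ((degreeOf_prod_le _ _ _).trans ?_)
  refine (sum_le_card_nsmul _ _ r fun b _ => hM _ _).trans ?_
  simp

end l1

end MvPolynomial

/-- A univariate zero estimate: an integer polynomial with small coefficients cannot vanish to high
order at a rational point with large denominator. -/
theorem Polynomial.exists_hasseDeriv_eval_ne_zero (f : Polynomial ℤ) (hf : f ≠ 0) (x : ℚ) :
    ∃ ν : ℕ, ((Polynomial.hasseDeriv ν f).map (Int.castRingHom ℚ)).eval x ≠ 0 ∧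
      x.den ^ ν ≤ f.leadingCoeff.natAbs := by
  have hinj : Function.Injective (Int.castRingHom ℚ) := (Int.castRingHom ℚ).injective_int
  set g := f.map (Int.castRingHom ℚ) with hg
  have hg0 : g ≠ 0 := (Polynomial.map_ne_zero_iff hinj).mpr hf
  refine ⟨g.rootMultiplicity x, ?_, ?_⟩
  · have h1 : (Polynomial.hasseDeriv (g.rootMultiplicity x) f).map (Int.castRingHom ℚ) =
        Polynomial.hasseDeriv (g.rootMultiplicity x) g := by
      ext n
      simp [hg, Polynomial.hasseDeriv_coeff]
    rw [h1, ← Polynomial.taylor_coeff, Polynomial.rootMultiplicity_eq_natTrailingDegree,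
      ← Polynomial.taylor_apply]
    exact Polynomial.trailingCoeff_nonzero_iff_nonzero.mpr
      ((map_ne_zero_iff _ (Polynomial.taylor_injective x)).mpr hg0)
  · set q : Polynomial ℤ := Polynomial.C (x.den : ℤ) * Polynomial.X - Polynomial.C x.num with hq
    have hprim : ∀ n, (q ^ n).IsPrimitive := by
      intro n
      induction n with
      | zero => rw [pow_zero]; exact Polynomial.isPrimitive_one
      | succ n ih =>
        rw [pow_succ]
        refine ih.mul ?_
        rw [Polynomial.isPrimitive_iff_isUnit_of_C_dvd]
        intro r hr
        rw [Polynomial.C_dvd_iff_dvd_coeff] at hr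
        have h0 := hr 0
        have h1 := hr 1
        rw [hq, Polynomial.coeff_sub, Polynomial.coeff_C_mul, Polynomial.coeff_X_zero, mul_zero,
          Polynomial.coeff_C_zero, zero_sub, dvd_neg] at h0
        rw [hq, Polynomial.coeff_sub, Polynomial.coeff_C_mul, Polynomial.coeff_X_one, mul_one,
          Polynomial.coeff_C_succ, sub_zero] at h1
        exact Int.isUnit_iff_natAbs_eq.mpr (Nat.dvd_one.mp (x.reduced ▸ Nat.dvd_gcd
          (Int.natAbs_dvd_natAbs.mpr h0) (by simpa using Int.natAbs_dvd_natAbs.mpr h1)))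
    have hdvd : q ^ g.rootMultiplicity x ∣ f := by
      refine (hprim _).dvd_of_fraction_map_dvd_fraction_map (K := ℚ) ?_
      have : q.map (algebraMap ℤ ℚ) =
          Polynomial.C (x.den : ℚ) * (Polynomial.X - Polynomial.C x) := by
        rw [mul_sub, ← Polynomial.C_mul, mul_comm (x.den : ℚ) x, Rat.mul_den_eq_num]
        simp [hq]
      rw [Polynomial.map_pow, this, mul_pow, ← Polynomial.C_pow]
      refine (Polynomial.C_mul_dvd (pow_ne_zero _ (by exact_mod_cast x.den_nz))).mpr ?_
      exact Polynomial.pow_rootMultiplicity_dvd g x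
    have hlead := Polynomial.leadingCoeff_dvd_leadingCoeff hdvd
    have hqlead : q.leadingCoeff = x.den := by
      rw [hq, Polynomial.leadingCoeff_sub_of_degree_lt, Polynomial.leadingCoeff_mul]
      · rw [Polynomial.leadingCoeff_C, Polynomial.leadingCoeff_X, mul_one]
      · rw [Polynomial.degree_C_mul (by exact_mod_cast x.den_nz), Polynomial.degree_X]
        exact Polynomial.degree_C_le.trans_lt one_pos
    rw [Polynomial.leadingCoeff_pow, hqlead] at hlead
    have := Int.natAbs_dvd_natAbs.mpr hlead
    rw [Int.natAbs_pow, Int.natAbs_natCast] at this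
    exact Nat.le_of_dvd (Int.natAbs_pos.mpr (Polynomial.leadingCoeff_ne_zero.mpr hf)) this

namespace MvPolynomial

open Finset

theorem exists_hasse_eval_ne_zero (V : MvPolynomial (Fin 1) ℤ) (hV : V ≠ 0) (x : ℚ) (hx : x ≠ 0) :
    ∃ ν : ℕ, eval (fun _ => x) (hasse (fun _ => ν) (map (Int.castRingHom ℚ) V)) ≠ 0 ∧
      x.den ^ ν ≤ l1 V := by
  classical
  set f : Polynomial ℤ := ∑ i ∈ V.support, Polynomial.monomial (i 0) (coeff i V) with hf
  have hsingle : ∀ b : Fin 1 →₀ ℕ, Finsupp.single 0 (b 0) = b := by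
    intro b
    refine Finsupp.ext fun j => ?_
    rw [Subsingleton.elim j 0, Finsupp.single_eq_same]
  have hcoeff : ∀ n, f.coeff n = coeff (Finsupp.single 0 n) V := by
    intro n
    rw [hf, Polynomial.finsetSum_coeff, sum_eq_single (Finsupp.single 0 n)]
    · simp
    · intro b _ hb
      rw [Polynomial.coeff_monomial, if_neg]
      rintro rfl
      exact hb (hsingle b).symm
    · intro h
      simp [notMem_support_iff.mp h]
  have hf0 : f ≠ 0 := by
    obtain ⟨i, hi⟩ := ne_zero_iff.mp hV
    intro h
    refine hi ?_
    rw [← hsingle i, ← hcoeff, h, Polynomial.coeff_zero]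
  obtain ⟨ν, h1, h2⟩ := f.exists_hasseDeriv_eval_ne_zero hf0 x
  refine ⟨ν, ?_, h2.trans ?_⟩
  · have : eval (fun _ => x) (hasse (fun _ => ν) (map (Int.castRingHom ℚ) V)) =
        x ^ ν * ((Polynomial.hasseDeriv ν f).map (Int.castRingHom ℚ)).eval x := by
      conv_lhs => rw [V.as_sum]
      rw [hf]
      simp only [map_sum, map_monomial, hasse_monomial, eval_monomial,
        Polynomial.hasseDeriv_monomial, Polynomial.map_sum, Polynomial.eval_finsetSum,
        Polynomial.map_monomial, Polynomial.eval_monomial, mul_sum]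
      refine sum_congr rfl fun i _ => ?_
      have hprod : (i.prod fun _ e => x ^ e) = x ^ i 0 := by
        conv_lhs => rw [← hsingle i]
        rw [Finsupp.prod_single_index (h := fun _ e => x ^ e) (pow_zero _)]
      rw [hprod]
      simp only [multichoose, Fin.prod_univ_succ, univ_eq_empty, prod_empty, mul_one]
      rcases lt_or_ge (i 0) ν with h | h
      · simp [Nat.choose_eq_zero_of_lt h]
      · obtain ⟨d, hd⟩ := Nat.exists_eq_add_of_le h
        rw [hd]
        simp only [pow_add, Nat.add_sub_cancel_left, eq_intCast]
        push_cast
        ring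
    rw [this]
    exact mul_ne_zero (pow_ne_zero _ hx) h1
  · rw [Polynomial.leadingCoeff, hcoeff]
    exact natAbs_coeff_le_l1 _ _

end MvPolynomial

open Finset in
theorem le_sum_max_sub_div {n r : ℕ} (hr : 0 < r) (hn : n ≤ r + 1) {A : ℝ} (hA : 0 < A)
    (hA1 : A ≤ 1) (ν : Fin n → ℕ) (hinj : ν.Injective) (hν : ∀ b, ν b + 1 ≤ n) :
    n * A ^ 2 / 8 ≤ ∑ b, max 0 (A - ν b * (r : ℝ)⁻¹) := by
  have hbij : Function.Bijective fun b => (⟨ν b, hν b⟩ : Fin n) :=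
    Finite.injective_iff_bijective.mp fun b b' h => hinj (Fin.mk.inj_iff.mp h)
  have h1 : ∑ b, max 0 (A - ν b * (r : ℝ)⁻¹) =
      ∑ b ∈ range n, max 0 (A - b * (r : ℝ)⁻¹) := by
    rw [← Fin.sum_univ_eq_sum_range fun b => max 0 (A - (b : ℝ) * (r : ℝ)⁻¹)]
    exact hbij.sum_comp fun b : Fin n => max 0 (A - (b : ℕ) * (r : ℝ)⁻¹)
  rw [h1]
  set K := ⌈n * A / 4⌉₊
  have hK : n * A / 4 ≤ K := Nat.le_ceil _
  have hKn : K ≤ n := by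
    refine Nat.ceil_le.mpr ?_
    nlinarith [(Nat.cast_nonneg n : (0 : ℝ) ≤ n)]
  have hr0 : (0 : ℝ) < r := by exact_mod_cast hr
  have hr1 : (1 : ℝ) ≤ r := by exact_mod_cast hr
  have hnr : (n : ℝ) ≤ r + 1 := by exact_mod_cast hn
  calc n * A ^ 2 / 8 ≤ K * (A / 2) := by nlinarith
    _ = ∑ b ∈ range K, A / 2 := by simp
    _ ≤ ∑ b ∈ range K, max 0 (A - b * (r : ℝ)⁻¹) := by
      refine sum_le_sum fun b hb => le_max_of_le_right ?_
      have hb' : (b : ℝ) < n * A / 4 := Nat.lt_ceil.mp (mem_range.mp hb)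
      have : (b : ℝ) * (r : ℝ)⁻¹ ≤ A / 2 := by
        rw [← div_eq_mul_inv, div_le_iff₀ hr0]
        nlinarith
      linarith
    _ ≤ ∑ b ∈ range n, max 0 (A - b * (r : ℝ)⁻¹) :=
      sum_le_sum_of_subset_of_nonneg (range_mono hKn) fun _ _ _ => le_max_left _ _

namespace MvPolynomial

open Finset

theorem VanishesTo.det_hasse {m n : ℕ} {R : Type*} [CommRing R] {w : Fin (m + 1) → ℝ}
    {x : Fin (m + 1) → R} (hw : ∀ j, 0 ≤ w j) {η s : ℝ} {P : MvPolynomial (Fin (m + 1)) R}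
    (hP : VanishesTo w x η P) (ν : Fin n → ℕ) (μ : Fin n → Fin m → ℕ)
    (hμ : ∀ a, ∑ l, μ a l * w l.succ ≤ s) :
    VanishesTo w x (∑ b, max 0 (η - s - ν b * w 0))
      (Matrix.of fun a b =>
        MvPolynomial.hasse (Fin.cons (ν b) (μ a) : Fin (m + 1) → ℕ) P).det := by
  rw [Matrix.det_apply]
  refine VanishesTo.sum _ _ fun π _ => ?_
  rw [Units.smul_def, ← Int.cast_smul_eq_zsmul R]
  refine VanishesTo.smul _ (VanishesTo.prod hw _ _ _ fun b _ => ?_)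
  rcases le_total 0 (η - s - ν b * w 0) with h | h
  · rw [max_eq_right h]
    refine (hP.hasse hw _).mono ?_
    rw [Fin.sum_univ_succ]
    simp only [Fin.cons_zero, Fin.cons_succ]
    linarith [hμ (π b)]
  · rw [max_eq_left h]
    exact VanishesTo.of_nonpos hw le_rfl _

/-- The coefficient of `X ^ c` in the variable `0`. -/
theorem exists_section_tail {m : ℕ} (W : MvPolynomial (Fin (m + 1)) ℤ) (c : ℕ) :
    ∃ U : MvPolynomial (Fin m) ℤ, (∀ a, coeff a U = coeff (Finsupp.cons c a) W) ∧
      l1 U ≤ l1 W := by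
  classical
  refine ⟨∑ i ∈ W.support with i 0 = c, monomial i.tail (coeff i W), fun a => ?_, ?_⟩
  · rw [coeff_sum, sum_eq_single (Finsupp.cons c a)]
    · simp
    · intro i hi h
      rw [coeff_monomial, if_neg]
      rintro rfl
      refine h ?_
      rw [← (mem_filter.mp hi).2, Finsupp.cons_tail]
    · intro h
      simp only [mem_filter, Finsupp.cons_zero, and_true, notMem_support_iff] at h
      simp [h]
  · refine (l1_sum_le _ _).trans ?_
    simp only [l1_monomial]
    exact sum_le_sum_of_subset (filter_subset _ _)

theorem exists_section_head {m : ℕ} (W : MvPolynomial (Fin (m + 1)) ℤ) (a : Fin m →₀ ℕ) :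
    ∃ V : MvPolynomial (Fin 1) ℤ, (∀ b, coeff b V = coeff (Finsupp.cons (b 0) a) W) ∧
      l1 V ≤ l1 W := by
  classical
  have hsingle : ∀ b : Fin 1 →₀ ℕ, Finsupp.single 0 (b 0) = b := by
    intro b
    refine Finsupp.ext fun j => ?_
    rw [Subsingleton.elim j 0, Finsupp.single_eq_same]
  refine ⟨∑ i ∈ W.support with i.tail = a, monomial (Finsupp.single 0 (i 0)) (coeff i W),
    fun b => ?_, ?_⟩
  · rw [coeff_sum, sum_eq_single (Finsupp.cons (b 0) a)]
    · simp [hsingle]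
    · intro i hi h
      rw [coeff_monomial, if_neg]
      rintro rfl
      refine h ?_
      rw [← (mem_filter.mp hi).2, Finsupp.single_eq_same, Finsupp.cons_tail]
    · intro h
      simp only [mem_filter, Finsupp.tail_cons, and_true, notMem_support_iff] at h
      simp [h]
  · refine (l1_sum_le _ _).trans ?_
    simp only [l1_monomial]
    exact sum_le_sum_of_subset (filter_subset _ _)

/-- The inductive step of Roth's lemma, splitting off the variable `0`. -/
theorem exists_tensor_factors {m : ℕ} (P : MvPolynomial (Fin (m + 1)) ℤ) (hP : P ≠ 0)
    (r : Fin (m + 1) → ℕ) (hr : ∀ j, P.degreeOf j ≤ r j) :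
    ∃ (n : ℕ) (ν : Fin n → ℕ) (μ : Fin n → Fin m → ℕ) (U : MvPolynomial (Fin m) ℤ)
      (V : MvPolynomial (Fin 1) ℤ), 0 < n ∧ n ≤ r 0 + 1 ∧ ν.Injective ∧ (∀ b, ν b + 1 ≤ n) ∧
      (∀ a, ∑ l, μ a l + 1 ≤ n) ∧ U ≠ 0 ∧ V ≠ 0 ∧ (∀ j, U.degreeOf j ≤ n * r j.succ) ∧
      l1 U ≤ n.factorial * (2 ^ (∑ j, r j) * l1 P) ^ n ∧
      l1 V ≤ n.factorial * (2 ^ (∑ j, r j) * l1 P) ^ n ∧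
      ∃ c : ℚ, c • (Matrix.of fun a b => hasse (Fin.cons (ν b) (μ a) : Fin (m + 1) → ℕ)
          (map (Int.castRingHom ℚ) P)).det =
        tensor (map (Int.castRingHom ℚ) U) (map (Int.castRingHom ℚ) V) := by
  have hinj : Function.Injective (Int.castRingHom ℚ) := (Int.castRingHom ℚ).injective_int
  obtain ⟨n, ν, μ, U, V, hn, hnr, hνinj, hν, hμ, hU, hV, hUV⟩ :=
    exists_det_hasse_eq_tensor (map (Int.castRingHom ℚ) P)
      ((map_injective _ hinj).ne_iff' (map_zero _) |>.mpr hP) (r := r 0) fun i hi =>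
        degreeOf_le_iff.mp (hr 0) i (support_map_subset _ _ hi)
  set W := (Matrix.of fun a b => hasse (Fin.cons (ν b) (μ a) : Fin (m + 1) → ℕ) P).det with hW
  have hmap : map (Int.castRingHom ℚ) W = tensor U V := by
    rw [← hUV, hW, RingHom.map_det]
    congr 1
    ext1 a b
    simp [map_hasse]
  have hl1 : l1 W ≤ n.factorial * (2 ^ (∑ j, r j) * l1 P) ^ n :=
    l1_det_le _ fun a b => l1_hasse_le _ _ _ hr
  have hdeg : ∀ j, W.degreeOf j ≤ n * r j := fun j => degreeOf_det_le _ _ _ fun a b =>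
    degreeOf_le_iff.mpr fun i hi => degreeOf_le_iff.mp (hr j) i (support_hasse_subset _ _ hi)
  have hcoeff : ∀ b a, ((coeff (Finsupp.cons b a) W : ℤ) : ℚ) =
      coeff a U * coeff (Finsupp.single 0 b) V := by
    intro b a
    rw [← eq_intCast (Int.castRingHom ℚ), ← coeff_map, hmap, coeff_tensor, Finsupp.tail_cons,
      Finsupp.cons_zero]
  obtain ⟨a₀, ha₀⟩ := ne_zero_iff.mp hU
  obtain ⟨b₀, hb₀⟩ := ne_zero_iff.mp hV
  have hsingle : ∀ b : Fin 1 →₀ ℕ, Finsupp.single 0 (b 0) = b := by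
    intro b
    refine Finsupp.ext fun j => ?_
    rw [Subsingleton.elim j 0, Finsupp.single_eq_same]
  obtain ⟨U₁, hU₁, hU₁W⟩ := exists_section_tail W (b₀ 0)
  obtain ⟨V₁, hV₁, hV₁W⟩ := exists_section_head W a₀
  have hU' : map (Int.castRingHom ℚ) U₁ = coeff b₀ V • U := by
    ext a
    rw [coeff_map, hU₁, eq_intCast, hcoeff, hsingle, coeff_smul, smul_eq_mul, mul_comm]
  have hV' : map (Int.castRingHom ℚ) V₁ = coeff a₀ U • V := by
    ext b
    rw [coeff_map, hV₁, eq_intCast, hcoeff, hsingle, coeff_smul, smul_eq_mul]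
  refine ⟨n, ν, μ, U₁, V₁, hn, hnr, hνinj, hν, hμ, ?_, ?_, fun j => ?_, hU₁W.trans hl1,
    hV₁W.trans hl1, coeff b₀ V * coeff a₀ U, ?_⟩
  · rintro rfl
    rw [map_zero] at hU'
    exact smul_ne_zero hb₀ hU hU'.symm
  · rintro rfl
    rw [map_zero] at hV'
    exact smul_ne_zero ha₀ hV hV'.symm
  · refine degreeOf_le_iff.mpr fun a ha => ?_
    rw [mem_support_iff, hU₁, ← mem_support_iff] at ha
    simpa using degreeOf_le_iff.mp (hdeg j.succ) _ ha
  · rw [hUV, hU', hV', tensor, tensor, map_smul, map_smul, smul_mul_smul_comm]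

/-- **Roth's lemma**, with the degrees in rapidly increasing order. -/
theorem roth_lemma (m : ℕ) : ∀ η : ℝ, 0 < η → ∃ s : ℝ, 0 < s ∧
    ∀ (r : Fin m → ℕ) (x : Fin m → ℚ) (P : MvPolynomial (Fin m) ℤ), P ≠ 0 → (∀ j, 0 < r j) →
      (∀ j, P.degreeOf j ≤ r j) → (∀ i j, i < j → (r i : ℝ) ≤ s * r j) → (∀ j, x j ≠ 0) →
      (∀ j, (∑ l, (r l : ℝ)) + Real.log (l1 P) ≤ s * r j * Real.log (x j).den) →
      ∃ μ : Fin m → ℕ, ∑ j, μ j * (r j : ℝ)⁻¹ ≤ η ∧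
        eval x (hasse μ (map (Int.castRingHom ℚ) P)) ≠ 0 := by
  induction m with
  | zero =>
    refine fun η hη => ⟨1, one_pos, fun r x P hP _ _ _ _ _ => ⟨0, by simpa using hη.le, ?_⟩⟩
    rw [eq_C_of_isEmpty P] at hP ⊢
    have hP' : coeff 0 P ≠ 0 := fun h => hP (by rw [h, C_0])
    rw [map_C, C_apply, hasse_monomial]
    simpa [multichoose] using hP'
  | succ m ih =>
    intro η₀ hη₀
    set η := min η₀ 1 with hηdef
    have hη : 0 < η := lt_min hη₀ one_pos
    have hη1 : η ≤ 1 := min_le_right _ _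
    obtain ⟨s', hs', H⟩ := ih (η ^ 2 / 100) (by positivity)
    refine ⟨min (s' / 4) (η ^ 2 / 400), lt_min (by positivity) (by positivity), ?_⟩
    set s := min (s' / 4) (η ^ 2 / 400) with hsdef
    have hs : 0 < s := lt_min (by positivity) (by positivity)
    have hs1 : s ≤ s' / 4 := min_le_left _ _
    have hs2 : s ≤ η ^ 2 / 400 := min_le_right _ _
    intro r x P hP hr0 hr hrr hx hlog
    by_contra! hcon
    set w : Fin (m + 1) → ℝ := fun j => (r j : ℝ)⁻¹ with hw
    have hw0 : ∀ j, 0 ≤ w j := fun j => inv_nonneg.mpr (Nat.cast_nonneg _)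
    have hvan : VanishesTo w x η (map (Int.castRingHom ℚ) P) := fun μ hμ =>
      hcon μ (hμ.le.trans (min_le_left _ _))
    obtain ⟨n, ν, μ, U, V, hn, hnr, hνinj, hν, hμ, hU, hV, hUdeg, hUl, hVl, c, hc⟩ :=
      exists_tensor_factors P hP r hr
    have hr0' : ∀ j, (0 : ℝ) < r j := fun j => by exact_mod_cast hr0 j
    have hn0 : (0 : ℝ) < n := by exact_mod_cast hn
    -- the logarithmic size of the determinant
    have hL : ∀ B : ℕ, 0 < B → B ≤ n.factorial * (2 ^ (∑ j, r j) * l1 P) ^ n →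
        Real.log B ≤ 2 * n * ((∑ l, (r l : ℝ)) + Real.log (l1 P)) := by
      intro B hB hle
      have h1 : n.factorial ≤ (2 ^ ∑ j, r j) ^ n := by
        refine (Nat.factorial_le_pow n).trans (Nat.pow_le_pow_left ?_ n)
        exact (hnr.trans (Nat.lt_two_pow_self (n := r 0))).trans (Nat.pow_le_pow_right two_pos
          (single_le_sum (f := r) (fun _ _ => Nat.zero_le _) (mem_univ 0)))
      have h2 : B ≤ (2 ^ (∑ j, r j) * (2 ^ (∑ j, r j) * l1 P)) ^ n := by
        rw [mul_pow]
        exact hle.trans (Nat.mul_le_mul_right _ h1)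
      have h3 : Real.log B ≤ Real.log (((2 ^ (∑ j, r j) * (2 ^ (∑ j, r j) * l1 P)) ^ n : ℕ) : ℝ) :=
        Real.log_le_log (by exact_mod_cast hB) (by exact_mod_cast h2)
      have hl1 : (1 : ℝ) ≤ l1 P := by exact_mod_cast one_le_l1 hP
      have hl0 := Real.log_nonneg hl1
      have h2' : Real.log 2 ≤ 1 := Real.log_two_lt_d9.le.trans (by norm_num)
      refine h3.trans ?_
      push_cast
      rw [Real.log_pow, Real.log_mul (by positivity) (by positivity),
        Real.log_mul (by positivity) (by positivity), Real.log_pow, mul_comm 2 (n : ℝ), mul_assoc]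
      push_cast
      have hS : 0 ≤ ∑ l, (r l : ℝ) := sum_nonneg fun _ _ => Nat.cast_nonneg _
      gcongr
      nlinarith
    have hT0 : 0 < (∑ l, (r l : ℝ)) + Real.log (l1 P) := by
      refine add_pos_of_pos_of_nonneg (sum_pos (fun j _ => hr0' j) univ_nonempty) ?_
      exact Real.log_nonneg (by exact_mod_cast one_le_l1 hP)
    set T := (∑ l, (r l : ℝ)) + Real.log (l1 P) with hT
    have hdet : VanishesTo w x (n * (η - s) ^ 2 / 8)
        (tensor (map (Int.castRingHom ℚ) U) (map (Int.castRingHom ℚ) V)) := by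
      rw [← hc]
      refine VanishesTo.smul c ((hvan.det_hasse (s := s) hw0 ν μ fun a => ?_).mono
        (le_sum_max_sub_div (hr0 0) hnr ?_ ?_ ν hνinj hν))
      · have h1 : ∀ l : Fin m, w l.succ ≤ s * w 0 := by
          intro l
          have := hrr 0 l.succ (Fin.succ_pos l)
          simp only [hw]
          rw [inv_le_iff_one_le_mul₀ (hr0' _), mul_right_comm, ← div_eq_mul_inv,
            one_le_div (hr0' _)]
          exact this
        calc ∑ l, μ a l * w l.succ ≤ ∑ l, (μ a l : ℝ) * (s * w 0) := by
              gcongr with l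
              exact h1 l
          _ = ((∑ l, μ a l : ℕ) : ℝ) * (s * w 0) := by rw [← sum_mul]; push_cast; rfl
          _ ≤ r 0 * (s * w 0) := by
              have : ∑ l, μ a l ≤ r 0 := by have := hμ a; omega
              have := hw0 0
              gcongr
          _ = s := by
              simp only [hw]
              field_simp [(hr0' 0).ne']
      · nlinarith
      · linarith
    have hratio : ∀ i j : Fin m, i < j →
        ((n * r i.succ : ℕ) : ℝ) ≤ s' * (n * r j.succ : ℕ) := by
      intro i j hij
      have := hrr i.succ j.succ (Fin.succ_lt_succ_iff.mpr hij)
      push_cast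
      have h4 : s * r j.succ ≤ s' * r j.succ := by gcongr; linarith
      nlinarith
    have hsize : ∀ j : Fin m, (∑ l : Fin m, ((n * r l.succ : ℕ) : ℝ)) + Real.log (l1 U) ≤
        s' * (n * r j.succ : ℕ) * Real.log (x j.succ).den := by
      intro j
      have h1 := hlog j.succ
      have h2 := hL (l1 U) (one_le_l1 hU) hUl
      have h3 : ∑ l : Fin m, (r l.succ : ℝ) ≤ T := by
        rw [hT, Fin.sum_univ_succ]
        have := Real.log_nonneg (x := l1 P) (by exact_mod_cast one_le_l1 hP)
        linarith [hr0' 0]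
      push_cast
      rw [← mul_sum]
      have h4 : T ≤ s' / 4 * (r j.succ * Real.log (x j.succ).den) := by
        have : s * (r j.succ * Real.log (x j.succ).den) ≤
            s' / 4 * (r j.succ * Real.log (x j.succ).den) := by
          gcongr
        linarith
      nlinarith [mul_le_mul_of_nonneg_left h4 hn0.le, mul_le_mul_of_nonneg_left h3 hn0.le]
    obtain ⟨lam, hlam, hUne⟩ := H (fun j => n * r j.succ) (fun j => x j.succ) U hU
      (fun j => Nat.mul_pos hn (hr0 _)) hUdeg hratio (fun j => hx _) hsize
    obtain ⟨κ, hVne, hκ⟩ := exists_hasse_eval_ne_zero V hV (x 0) (hx 0)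
    have hκle : (κ : ℝ) * w 0 ≤ 2 * n * s := by
      have h1 : κ * Real.log (x 0).den ≤ 2 * n * T := by
        rw [← Real.log_pow, ← Nat.cast_pow]
        refine hL _ (pow_pos (x 0).den_pos _) (hκ.trans hVl)
      have h2 := hlog 0
      have h3 : 0 < Real.log (x 0).den := by
        have := hT0.trans_le h2
        exact (pos_iff_pos_of_mul_pos this).mp (mul_pos hs (hr0' 0))
      simp only [hw]
      rw [← div_eq_mul_inv, div_le_iff₀ (hr0' 0)]
      refine le_of_mul_le_mul_right (h1.trans ?_) h3
      calc 2 * n * T ≤ 2 * n * (s * r 0 * Real.log (x 0).den) := by gcongr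
        _ = _ := by ring
    have hzero := hdet (Fin.cons κ lam) (by
      rw [Fin.sum_univ_succ]
      simp only [Fin.cons_zero, Fin.cons_succ]
      have h1 : ∑ j, (lam j : ℝ) * w j.succ ≤ n * (η ^ 2 / 100) := by
        have : ∑ j, (lam j : ℝ) * w j.succ =
            n * ∑ j, (lam j : ℝ) * (((n * r j.succ : ℕ) : ℝ))⁻¹ := by
          rw [mul_sum]
          refine sum_congr rfl fun j _ => ?_
          have := (hr0' j.succ).ne'
          simp only [hw]
          push_cast
          field_simp
        rw [this]
        gcongr
      have h2 : s ≤ η / 400 := by nlinarith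
      have h3 : η ^ 2 / 4 ≤ (η - s) ^ 2 := by nlinarith
      nlinarith [mul_pos hn0 (pow_pos hη 2)])
    rw [hasse_tensor, eval_tensor] at hzero
    exact mul_ne_zero hUne hVne hzero

end MvPolynomial

section AuxiliaryPolynomial

open Finset

section Counting

variable {m : ℕ} (r : Fin m → ℕ)

theorem sum_sq_sum_sub_half_le (hr : ∀ j, 0 < r j) :
    ∑ i : (∀ j, Fin (r j + 1)), (∑ j, ((i j : ℝ) * (r j : ℝ)⁻¹ - 1 / 2)) ^ 2 ≤
      Fintype.card (∀ j, Fin (r j + 1)) * (m / 4) := by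
  set g : ∀ j, Fin (r j + 1) → ℝ := fun j a => (a : ℝ) * (r j : ℝ)⁻¹ - 1 / 2 with hg
  have hrev : ∀ j a, g j (Fin.rev a) = -g j a := by
    intro j a
    have hr0 : (r j : ℝ) ≠ 0 := by exact_mod_cast (hr j).ne'
    have ha : (a : ℕ) ≤ r j := Nat.lt_succ_iff.mp a.2
    simp only [hg, Fin.val_rev, Nat.add_sub_add_right]
    rw [Nat.cast_sub ha]
    field_simp
    ring
  have hsq : ∀ j a, g j a ^ 2 ≤ 1 / 4 := by
    intro j a
    have hr0 : (0 : ℝ) < r j := by exact_mod_cast hr j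
    have ha : (a : ℝ) ≤ r j := by exact_mod_cast Nat.lt_succ_iff.mp a.2
    have h1 : (a : ℝ) * (r j : ℝ)⁻¹ ≤ 1 := by rwa [← div_eq_mul_inv, div_le_one hr0]
    have h0 : 0 ≤ (a : ℝ) * (r j : ℝ)⁻¹ := by positivity
    simp only [hg]
    nlinarith
  suffices H : ∀ s : Finset (Fin m), ∑ i : (∀ j, Fin (r j + 1)), (∑ j ∈ s, g j (i j)) ^ 2 ≤
      Fintype.card (∀ j, Fin (r j + 1)) * (s.card / 4 : ℝ) by
    have h := H univ
    rw [card_univ, Fintype.card_fin] at h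
    exact h
  intro s
  induction s using Finset.induction_on with
  | empty => simp
  | insert a s ha ih =>
    have hcross : ∑ i : (∀ j, Fin (r j + 1)), g a (i a) * ∑ j ∈ s, g j (i j) = 0 := by
      have hinv : Function.Involutive fun i : (∀ j, Fin (r j + 1)) =>
          Function.update i a (Fin.rev (i a)) := fun i => by simp
      have := Equiv.sum_comp hinv.toPerm fun i => g a (i a) * ∑ j ∈ s, g j (i j)
      simp only [Function.Involutive.coe_toPerm, Function.update_self, hrev] at this
      have h2 : ∀ i : (∀ j, Fin (r j + 1)),
          ∑ j ∈ s, g j (Function.update i a (Fin.rev (i a)) j) = ∑ j ∈ s, g j (i j) := fun i =>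
        sum_congr rfl fun j hj => by
          rw [Function.update_of_ne (ne_of_mem_of_not_mem hj ha)]
      simp only [h2, neg_mul, sum_neg_distrib] at this
      linarith
    calc ∑ i : (∀ j, Fin (r j + 1)), (∑ j ∈ insert a s, g j (i j)) ^ 2
        = ∑ i : (∀ j, Fin (r j + 1)), (g a (i a) ^ 2 + 2 * (g a (i a) * ∑ j ∈ s, g j (i j)) +
            (∑ j ∈ s, g j (i j)) ^ 2) := by
          refine sum_congr rfl fun i _ => ?_
          rw [sum_insert ha]
          ring
      _ = ∑ i : (∀ j, Fin (r j + 1)), g a (i a) ^ 2 +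
            ∑ i : (∀ j, Fin (r j + 1)), (∑ j ∈ s, g j (i j)) ^ 2 := by
          rw [sum_add_distrib, sum_add_distrib, ← mul_sum, hcross, mul_zero, add_zero]
      _ ≤ ∑ i : (∀ j, Fin (r j + 1)), (1 / 4 : ℝ) +
            Fintype.card (∀ j, Fin (r j + 1)) * (s.card / 4 : ℝ) :=
          add_le_add (sum_le_sum fun i _ => hsq a _) ih
      _ = _ := by
          rw [card_insert_of_notMem ha, sum_const, card_univ, nsmul_eq_mul]
          push_cast
          ring

theorem card_tail_le (hr : ∀ j, 0 < r j) {δ : ℝ} (hδ : 0 < δ) (hm : 0 < m)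
    (T : Finset (∀ j, Fin (r j + 1)))
    (hT : ∀ i ∈ T, δ * m / 2 ≤ |∑ j, (i j : ℝ) * (r j : ℝ)⁻¹ - m / 2|) :
    T.card * (δ ^ 2 * m) ≤ Fintype.card (∀ j, Fin (r j + 1)) := by
  have hm0 : (0 : ℝ) < m := by exact_mod_cast hm
  have h1 : ∑ i ∈ T, (δ * m / 2) ^ 2 ≤ Fintype.card (∀ j, Fin (r j + 1)) * (m / 4 : ℝ) := by
    refine le_trans ?_ (sum_sq_sum_sub_half_le r hr)
    refine (sum_le_sum fun i hi => ?_).trans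
      (sum_le_univ_sum_of_nonneg fun i => sq_nonneg _)
    rw [← sq_abs (∑ j, _)]
    refine pow_le_pow_left₀ (by positivity) ?_ 2
    have : ∑ j, ((i j : ℝ) * (r j : ℝ)⁻¹ - 1 / 2) = ∑ j, (i j : ℝ) * (r j : ℝ)⁻¹ - m / 2 := by
      rw [sum_sub_distrib]
      simp
      ring
    rw [this]
    exact hT i hi
  rw [sum_const, nsmul_eq_mul] at h1
  have h2 : (m / 4 : ℝ) * (T.card * (δ ^ 2 * m)) ≤
      (m / 4 : ℝ) * Fintype.card (∀ j, Fin (r j + 1)) := by linarith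
  exact le_of_mul_le_mul_left h2 (by positivity)

theorem exists_residue_card {q : ℕ} (hq : 0 < q) :
    ∃ s < q, Fintype.card (∀ j, Fin (r j + 1)) ≤
      q * (univ.filter fun i : (∀ j, Fin (r j + 1)) => (∑ j, (i j : ℕ)) % q = s).card := by
  by_contra! h
  have h1 : Fintype.card (∀ j, Fin (r j + 1)) = ∑ s ∈ range q,
      (univ.filter fun i : (∀ j, Fin (r j + 1)) => (∑ j, (i j : ℕ)) % q = s).card :=
    card_eq_sum_card_fiberwise fun i _ => mem_coe.mpr (mem_range.mpr (Nat.mod_lt _ hq))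
  have h2 : ∑ s ∈ range q,
      q * (univ.filter fun i : (∀ j, Fin (r j + 1)) => (∑ j, (i j : ℕ)) % q = s).card <
      ∑ s ∈ range q, Fintype.card (∀ j, Fin (r j + 1)) :=
    sum_lt_sum_of_nonempty ⟨0, mem_range.mpr hq⟩ fun s hs => h s (mem_range.mp hs)
  rw [← mul_sum, ← h1, sum_const, card_range, smul_eq_mul] at h2
  exact lt_irrefl _ h2

end Counting

attribute [local instance] Matrix.seminormedAddCommGroup in
/-- Siegel's lemma for an integer matrix with far more columns than rows. -/
theorem exists_int_vec_bounded {α β : Type*} [Fintype α] [Fintype β] [DecidableEq α]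
    [DecidableEq β] (hα : 0 < Fintype.card α) (h : 2 * Fintype.card α ≤ Fintype.card β)
    (A : Matrix α β ℤ) {B : ℕ} (hB : 1 ≤ B) (hA : ∀ a b, (A a b).natAbs ≤ B) :
    ∃ t : β → ℤ, t ≠ 0 ∧ A.mulVec t = 0 ∧ ∀ b, (t b).natAbs ≤ Fintype.card β * B := by
  obtain ⟨t, ht, hAt, hn⟩ := Int.Matrix.exists_ne_zero_int_vec_norm_le A (by omega) hα
  refine ⟨t, ht, hAt, fun b => ?_⟩
  have h_norm_eq : ∀ z : ℤ, ‖z‖ = (z.natAbs : ℝ) := fun z => by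
    rw [Int.norm_eq_abs, Nat.cast_natAbs, Int.cast_abs]
  have hnorm : ‖A‖ ≤ B := by
    refine (Matrix.norm_le_iff (Nat.cast_nonneg _)).mpr fun a b => ?_
    refine (h_norm_eq _).le.trans ?_
    exact_mod_cast hA a b
  have hB' : (1 : ℝ) ≤ B := by exact_mod_cast hB
  have hα' : (0 : ℝ) < Fintype.card α := by exact_mod_cast hα
  have h' : 2 * (Fintype.card α : ℝ) ≤ Fintype.card β := by exact_mod_cast h
  have h1 : (1 : ℝ) ≤ Fintype.card β * max 1 ‖A‖ := by
    have : (1 : ℝ) ≤ Fintype.card β := by exact_mod_cast (by omega : 1 ≤ Fintype.card β)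
    nlinarith [le_max_left 1 ‖A‖]
  have h2 : ‖t‖ ≤ Fintype.card β * max 1 ‖A‖ := by
    refine hn.trans ?_
    refine (Real.rpow_le_rpow_of_exponent_le h1 ?_).trans (Real.rpow_one _).le
    rw [div_le_one (by linarith)]
    linarith
  have h3 : ((t b).natAbs : ℝ) ≤ Fintype.card β * B := by
    have := (norm_le_pi_norm t b).trans (h2.trans
      (mul_le_mul_of_nonneg_left (max_le hB' hnorm) (Nat.cast_nonneg _)))
    rwa [h_norm_eq] at this
  exact_mod_cast h3

open MvPolynomial in
/-- Siegel's lemma produces a polynomial with few monomials vanishing to high order at `1`. -/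
theorem exists_auxiliary_polynomial {m q : ℕ} (hm : 0 < m) (hq : 0 < q) {δ : ℝ} (hδ : 0 < δ)
    (hδ1 : δ < 1) (hmq : 4 * q ≤ δ ^ 2 * m) (r : Fin m → ℕ) (hr : ∀ j, 0 < r j) :
    ∃ s < q, ∃ Q : MvPolynomial (Fin m) ℤ, Q ≠ 0 ∧ (∀ j, Q.degreeOf j ≤ r j) ∧
      l1 Q ≤ 8 ^ ∑ j, r j ∧ (∀ i ∈ Q.support, (∑ j, i j) % q = s) ∧
      (∀ i ∈ Q.support, ∑ j, (i j : ℝ) * (r j : ℝ)⁻¹ ≤ m / 2 * (1 + δ)) ∧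
      VanishesTo (fun j => (r j : ℝ)⁻¹) 1 (m / 2 * (1 - δ)) Q := by
  classical
  have hm0 : (0 : ℝ) < m := by exact_mod_cast hm
  obtain ⟨s, hs, hsq⟩ := exists_residue_card r hq
  refine ⟨s, hs, ?_⟩
  set V := Fintype.card (∀ j, Fin (r j + 1)) with hV
  have hV2 : V ≤ 2 ^ ∑ j, r j := by
    rw [hV, Fintype.card_pi, ← prod_pow_eq_pow_sum]
    refine prod_le_prod' fun j _ => ?_
    rw [Fintype.card_fin]
    exact Nat.lt_two_pow_self
  set wt : (∀ j, Fin (r j + 1)) → ℝ := fun i => ∑ j, (i j : ℝ) * (r j : ℝ)⁻¹ with hwt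
  have htail : ∀ T : Finset (∀ j, Fin (r j + 1)), (∀ i ∈ T, δ * m / 2 ≤ |wt i - m / 2|) →
      4 * q * T.card ≤ V := by
    intro T hT
    have h1 := card_tail_le r hr hδ hm T hT
    have h2 : (4 * q : ℝ) * T.card ≤ V :=
      le_trans (by rw [mul_comm]; exact mul_le_mul_of_nonneg_left hmq (Nat.cast_nonneg _)) h1
    exact_mod_cast h2
  set S := univ.filter fun i : (∀ j, Fin (r j + 1)) => (∑ j, (i j : ℕ)) % q = s with hS
  set G := S.filter fun i => wt i ≤ m / 2 * (1 + δ) with hG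
  set D := univ.filter fun i : (∀ j, Fin (r j + 1)) => wt i < m / 2 * (1 - δ) with hD
  have hDcard : 4 * q * D.card ≤ V := htail D fun i hi => by
    have := (mem_filter.mp hi).2
    rw [abs_sub_comm]
    refine le_trans ?_ (le_abs_self _)
    linarith
  have hBcard : 4 * q * (S.filter fun i => ¬ wt i ≤ m / 2 * (1 + δ)).card ≤ V :=
    htail _ fun i hi => by
      have := not_le.mp (mem_filter.mp hi).2
      refine le_trans ?_ (le_abs_self _)
      linarith
  have hGB : G.card + (S.filter fun i => ¬ wt i ≤ m / 2 * (1 + δ)).card = S.card :=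
    card_filter_add_card_filter_not _
  have hGcard : 2 * D.card ≤ G.card := by
    have h1 : q * S.card = q * G.card + q * (S.filter fun i => ¬ wt i ≤ m / 2 * (1 + δ)).card := by
      rw [← hGB, mul_add]
    refine Nat.le_of_mul_le_mul_left ?_ (Nat.mul_pos four_pos hq)
    nlinarith
  have hDpos : 0 < D.card := card_pos.mpr ⟨fun _ => 0, mem_filter.mpr ⟨mem_univ _, by
    have : 0 < m / 2 * (1 - δ) := by
      have : 0 < 1 - δ := by linarith
      positivity
    simpa [hwt] using this⟩⟩
  have hGV : G.card ≤ 2 ^ ∑ j, r j := (card_le_univ G).trans hV2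
  have hle : ∀ i : (∀ j, Fin (r j + 1)), ∑ j, (i j : ℕ) ≤ ∑ j, r j := fun i =>
    sum_le_sum fun j _ => Nat.lt_succ_iff.mp (i j).2
  obtain ⟨c, hc, hAc, hcB⟩ := exists_int_vec_bounded (α := D) (β := G) (by simpa using hDpos)
    (by simpa using hGcard)
    (Matrix.of fun t i => (multichoose (fun j => (i.1 j : ℕ)) (fun j => (t.1 j : ℕ)) : ℤ))
    (B := 2 ^ ∑ j, r j) Nat.one_le_two_pow (fun t i => by
      rw [Matrix.of_apply, Int.natAbs_natCast]
      exact (multichoose_le_two_pow _ _).trans (Nat.pow_le_pow_right two_pos (hle _)))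
  set e : G → Fin m →₀ ℕ := fun i => Finsupp.equivFunOnFinite.symm fun j => (i.1 j : ℕ) with he
  have he_inj : e.Injective := fun i i' h => Subtype.ext (funext fun j => Fin.ext
    (congrFun (Finsupp.equivFunOnFinite.symm.injective h) j))
  set Q : MvPolynomial (Fin m) ℤ := ∑ i, monomial (e i) (c i) with hQ
  have hsupp : ∀ i ∈ Q.support, ∃ b : G, e b = i := by
    intro i hi
    by_contra! h
    refine mem_support_iff.mp hi ?_
    rw [hQ, coeff_sum]
    exact sum_eq_zero fun b _ => by rw [coeff_monomial, if_neg (h b)]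
  refine ⟨Q, ?_, ?_, ?_, ?_, ?_, ?_⟩
  · obtain ⟨b, hb⟩ := Function.ne_iff.mp hc
    refine ne_zero_iff.mpr ⟨e b, ?_⟩
    rw [hQ, coeff_sum, sum_eq_single b]
    · simpa using hb
    · intro b' _ hbb
      rw [coeff_monomial, if_neg (he_inj.ne hbb)]
    · exact fun h => absurd (mem_univ b) h
  · refine fun j => degreeOf_le_iff.mpr fun i hi => ?_
    obtain ⟨b, rfl⟩ := hsupp i hi
    exact Nat.lt_succ_iff.mp (b.1 j).2
  · refine (l1_sum_le _ _).trans ?_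
    simp only [l1_monomial]
    refine (sum_le_card_nsmul _ _ _ fun b _ => hcB b).trans ?_
    rw [card_univ, Fintype.card_coe, smul_eq_mul]
    calc G.card * (G.card * 2 ^ ∑ j, r j)
        ≤ 2 ^ (∑ j, r j) * (2 ^ (∑ j, r j) * 2 ^ ∑ j, r j) := by gcongr
      _ = 8 ^ ∑ j, r j := by rw [← mul_pow, ← mul_pow]; norm_num
  · intro i hi
    obtain ⟨b, rfl⟩ := hsupp i hi
    exact (mem_filter.mp (mem_filter.mp b.2).1).2
  · intro i hi
    obtain ⟨b, rfl⟩ := hsupp i hi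
    exact (mem_filter.mp b.2).2
  · intro t ht
    have heval : eval 1 (hasse t Q) =
        ∑ b : G, (multichoose (fun j => (b.1 j : ℕ)) t : ℤ) * c b := by
      rw [hQ, map_sum, map_sum]
      refine sum_congr rfl fun b _ => ?_
      rw [hasse_monomial, eval_monomial]
      simp [he]
    rw [heval]
    by_cases htr : ∀ j, t j ≤ r j
    · have := congrFun hAc ⟨fun j => ⟨t j, Nat.lt_succ_of_le (htr j)⟩,
        mem_filter.mpr ⟨mem_univ _, ht⟩⟩
      simpa [Matrix.mulVec, dotProduct] using this
    · push Not at htr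
      obtain ⟨j, hj⟩ := htr
      refine sum_eq_zero fun b _ => ?_
      rw [multichoose, prod_eq_zero (mem_univ j), Nat.cast_zero, zero_mul]
      exact Nat.choose_eq_zero_of_lt ((Nat.lt_succ_iff.mp (b.1 j).2).trans_lt hj)

end AuxiliaryPolynomial

namespace MvPolynomial

open Finset

theorem eval_hasse {σ R : Type*} [Fintype σ] [CommRing R] (x : σ → R) (u : σ → ℕ)
    (G : MvPolynomial σ R) : eval x (hasse u G) =
      ∑ i ∈ G.support, (multichoose i u * coeff i G) * ∏ j, x j ^ i j := by
  conv_lhs => rw [G.as_sum]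
  rw [map_sum, map_sum]
  refine sum_congr rfl fun i _ => ?_
  rw [hasse_monomial, eval_monomial, Finsupp.prod_fintype _ _ fun _ => pow_zero _]

theorem eval_one_add {m : ℕ} {R : Type*} [CommRing R] (d : Fin m → R) (r : Fin m → ℕ)
    (G : MvPolynomial (Fin m) R) (hr : ∀ j, G.degreeOf j ≤ r j) :
    eval (fun j => 1 + d j) G =
      ∑ u ∈ Fintype.piFinset fun j => range (r j + 1), (∏ j, d j ^ u j) * eval 1 (hasse u G) := by
  simp only [eval_hasse, Pi.one_apply, one_pow, prod_const_one, mul_one]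
  rw [eval_eq']
  simp only [mul_sum]
  rw [sum_comm]
  refine sum_congr rfl fun i hi => ?_
  have h1 : ∀ j, (1 + d j) ^ i j = ∑ u ∈ range (r j + 1), d j ^ u * ((i j).choose u : R) := by
    intro j
    rw [add_comm, add_pow]
    refine (sum_subset (range_mono (Nat.succ_le_succ (degreeOf_le_iff.mp (hr j) i hi)))
      fun u _ hu => ?_).trans (sum_congr rfl fun u _ => ?_)
    · rw [Nat.choose_eq_zero_of_lt (by simpa using hu), Nat.cast_zero, mul_zero]
    · rw [one_pow, mul_one]
  simp only [h1, prod_univ_sum, mul_sum]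
  refine sum_congr rfl fun u _ => ?_
  rw [prod_mul_distrib, multichoose]
  push_cast
  ring

theorem natAbs_eval_one_le {σ : Type*} (Q : MvPolynomial σ ℤ) : (eval 1 Q).natAbs ≤ l1 Q := by
  rw [eval_eq]
  refine (Int.natAbs_sum_le _ _).trans (sum_le_sum fun i _ => ?_)
  simp

/-- A polynomial vanishing to high order at `1` is small near `1`. -/
theorem VanishesTo.abs_eval_one_add_le {m : ℕ} {w : Fin m → ℝ} {τ : ℝ}
    {Q : MvPolynomial (Fin m) ℤ} (hw : ∀ j, 0 ≤ w j) (hQ : VanishesTo w 1 τ Q) (r : Fin m → ℕ)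
    (hr : ∀ j, Q.degreeOf j ≤ r j) (t : Fin m → ℕ) {K E : ℝ} (hK : 1 ≤ K) (hE : 0 ≤ E)
    (d : Fin m → ℝ) (hd : ∀ j, |d j| ≤ K ^ (-(E * w j))) :
    |eval (fun j => 1 + d j) (MvPolynomial.hasse t (map (Int.castRingHom ℝ) Q))| ≤
      8 ^ (∑ j, r j) * l1 Q * K ^ (-(E * (τ - ∑ j, t j * w j))) := by
  have hK0 : 0 < K := by linarith
  have hGr : ∀ j, (MvPolynomial.hasse t Q).degreeOf j ≤ r j := fun j =>
    degreeOf_le_iff.mpr fun i hi => degreeOf_le_iff.mp (hr j) i (support_hasse_subset _ _ hi)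
  have hG := hQ.hasse hw t
  have hGl := l1_hasse_le t Q r hr
  rw [← map_hasse]
  set G := MvPolynomial.hasse t Q with hGdef
  set θ := τ - ∑ j, t j * w j with hθ
  rw [eval_one_add d r _ fun j => (degreeOf_le_iff.mpr fun i hi =>
    degreeOf_le_iff.mp (hGr j) i (support_map_subset _ _ hi))]
  have hterm : ∀ u : Fin m → ℕ, |(∏ j, d j ^ u j) *
      eval 1 (MvPolynomial.hasse u (map (Int.castRingHom ℝ) G))| ≤
      K ^ (-(E * θ)) * (2 ^ (∑ j, r j) * (2 ^ (∑ j, r j) * l1 Q)) := by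
    intro u
    have hev : eval 1 (MvPolynomial.hasse u (map (Int.castRingHom ℝ) G)) =
        ((eval 1 (MvPolynomial.hasse u G) : ℤ) : ℝ) := by
      rw [← map_hasse, ← eq_intCast (Int.castRingHom ℝ), eval_map, eval₂_comp]
      congr 1
      funext j
      simp
    rw [hev]
    rcases lt_or_ge (∑ j, u j * w j) θ with h | h
    · rw [hG u h, Int.cast_zero, mul_zero, abs_zero]
      positivity
    · rw [abs_mul]
      refine mul_le_mul ?_ ?_ (abs_nonneg _) (by positivity)
      · rw [abs_prod]
        calc ∏ j, |d j ^ u j| ≤ ∏ j, K ^ (-(E * w j) * u j) := by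
              refine prod_le_prod (fun _ _ => abs_nonneg _) fun j _ => ?_
              rw [abs_pow, Real.rpow_mul hK0.le, Real.rpow_natCast]
              exact pow_le_pow_left₀ (abs_nonneg _) (hd j) _
          _ = K ^ (∑ j, -(E * w j) * u j) := (Real.rpow_sum_of_pos hK0 _ _).symm
          _ ≤ K ^ (-(E * θ)) := by
              refine Real.rpow_le_rpow_of_exponent_le hK ?_
              have : ∑ j, -(E * w j) * u j = -(E * ∑ j, u j * w j) := by
                rw [mul_sum, ← sum_neg_distrib]
                exact sum_congr rfl fun j _ => by ring
              rw [this]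
              exact neg_le_neg (mul_le_mul_of_nonneg_left h hE)
      · have h1 := (natAbs_eval_one_le (MvPolynomial.hasse u G)).trans
          ((l1_hasse_le u G r hGr).trans (Nat.mul_le_mul_left _ hGl))
        rw [← Int.cast_abs, ← Nat.cast_natAbs]
        exact_mod_cast h1
  refine (abs_sum_le_sum_abs _ _).trans ((sum_le_card_nsmul _ _ _ fun u _ => hterm u).trans ?_)
  have hcard : (Fintype.piFinset fun j => range (r j + 1)).card ≤ 2 ^ ∑ j, r j := by
    rw [Fintype.card_piFinset, ← prod_pow_eq_pow_sum]
    refine prod_le_prod' fun j _ => ?_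
    rw [card_range]
    exact Nat.lt_two_pow_self
  have hcard' : ((Fintype.piFinset fun j => range (r j + 1)).card : ℝ) ≤ 2 ^ ∑ j, r j := by
    exact_mod_cast hcard
  rw [nsmul_eq_mul]
  calc _ ≤ 2 ^ (∑ j, r j) * (K ^ (-(E * θ)) * (2 ^ (∑ j, r j) * (2 ^ (∑ j, r j) * l1 Q))) := by
        gcongr
    _ = ((2 * 2 * 2 : ℝ)) ^ (∑ j, r j) * l1 Q * K ^ (-(E * θ)) := by
        rw [mul_pow, mul_pow]
        ring
    _ = _ := by norm_num

theorem one_le_pow_mul_abs_eval {m : ℕ} (P : MvPolynomial (Fin m) ℤ) {k : ℕ} (hk : 0 < k)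
    (a : Fin m → ℤ) (N : Fin m → ℕ) (M : ℕ) (hM : ∀ i ∈ P.support, ∑ j, i j * N j ≤ M)
    (hne : eval (fun j => (a j : ℚ) / (k : ℚ) ^ N j) (map (Int.castRingHom ℚ) P) ≠ 0) :
    1 ≤ (k : ℚ) ^ M *
      |eval (fun j => (a j : ℚ) / (k : ℚ) ^ N j) (map (Int.castRingHom ℚ) P)| := by
  have hk0 : (0 : ℚ) < k := by exact_mod_cast hk
  set y := eval (fun j => (a j : ℚ) / (k : ℚ) ^ N j) (map (Int.castRingHom ℚ) P) with hy
  obtain ⟨z, hz⟩ : ∃ z : ℤ, (k : ℚ) ^ M * y = z := by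
    refine ⟨∑ i ∈ P.support, coeff i P * (∏ j, a j ^ i j) * k ^ (M - ∑ j, i j * N j), ?_⟩
    rw [hy, eval_map, eval₂_eq', mul_sum]
    push_cast
    refine sum_congr rfl fun i hi => ?_
    obtain ⟨e, he⟩ := Nat.exists_eq_add_of_le (hM i hi)
    have hprod : ∏ j, ((a j : ℚ) / (k : ℚ) ^ N j) ^ i j =
        (∏ j, (a j : ℚ) ^ i j) / (k : ℚ) ^ ∑ j, i j * N j := by
      rw [← prod_pow_eq_pow_sum, ← prod_div_distrib]
      refine prod_congr rfl fun j _ => ?_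
      rw [div_pow, ← pow_mul, mul_comm (N j)]
    rw [hprod, he, Nat.add_sub_cancel_left, pow_add, eq_intCast]
    field_simp
  have hz0 : z ≠ 0 := by
    rintro rfl
    rw [Int.cast_zero] at hz
    exact mul_ne_zero (pow_pos hk0 M).ne' hne hz
  rw [← abs_of_pos (pow_pos hk0 M), ← abs_mul, hz]
  exact_mod_cast Int.one_le_abs hz0

/-- Clearing the powers of `α` from the coefficients of `Q`, when `α ^ q = k ^ p` and all the
monomials of `Q` have the same degree modulo `q`. -/
theorem exists_twist {m p q s k : ℕ} (hk : 2 ≤ k) {α : ℝ} (hα : 0 < α)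
    (hαk : α ^ q = (k : ℝ) ^ p) (Q : MvPolynomial (Fin m) ℤ) (hQ : Q ≠ 0) (r : Fin m → ℕ)
    (hr : ∀ j, Q.degreeOf j ≤ r j) (hs : ∀ i ∈ Q.support, (∑ j, i j) % q = s) :
    ∃ P : MvPolynomial (Fin m) ℤ, P ≠ 0 ∧ P.support ⊆ Q.support ∧
      l1 P ≤ k ^ (p * ∑ j, r j) * l1 Q ∧ ∀ (t : Fin m → ℕ) (x : Fin m → ℚ),
        ((eval x (hasse t (map (Int.castRingHom ℚ) P)) : ℚ) : ℝ) =
          k ^ (p * ∑ j, r j) * α ^ s *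
            eval (fun j => (x j : ℝ) / α) (hasse t (map (Int.castRingHom ℝ) Q)) := by
  classical
  set S := ∑ j, r j with hS
  set κ : (Fin m →₀ ℕ) → ℕ := fun i => k ^ (p * (S - (∑ j, i j) / q)) with hκ
  have hk0 : 0 < k := by omega
  set P : MvPolynomial (Fin m) ℤ := ∑ i ∈ Q.support, monomial i (κ i * coeff i Q) with hP
  have hcoeff : ∀ i, coeff i P = κ i * coeff i Q := by
    intro i
    rw [hP, coeff_sum]
    simp only [coeff_monomial, sum_ite_eq']
    split_ifs with h
    · rfl
    · rw [notMem_support_iff.mp h, mul_zero]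
  have hsub : P.support ⊆ Q.support := fun i hi => by
    rw [mem_support_iff, hcoeff] at hi
    exact mem_support_iff.mpr (right_ne_zero_of_mul hi)
  refine ⟨P, ?_, hsub, ?_, fun t x => ?_⟩
  · obtain ⟨i, hi⟩ := ne_zero_iff.mp hQ
    refine ne_zero_iff.mpr ⟨i, ?_⟩
    rw [hcoeff]
    exact mul_ne_zero (by exact_mod_cast (pow_pos hk0 _).ne') hi
  · rw [l1_eq_sum hsub, l1, mul_sum]
    refine sum_le_sum fun i _ => ?_
    rw [hcoeff, Int.natAbs_mul, Int.natAbs_natCast]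
    exact Nat.mul_le_mul_right _ (Nat.pow_le_pow_right hk0
      (Nat.mul_le_mul_left _ (Nat.sub_le _ _)))
  · have h1 : eval x (hasse t (map (Int.castRingHom ℚ) P)) =
        ∑ i ∈ Q.support, (multichoose i t * (κ i * coeff i Q : ℤ)) * ∏ j, x j ^ i j := by
      rw [hP, map_sum, map_sum, map_sum]
      refine sum_congr rfl fun i _ => ?_
      rw [map_monomial, hasse_monomial, eval_monomial,
        Finsupp.prod_fintype _ _ fun _ => pow_zero _, eq_intCast]
    have h2 : ∀ z : Fin m → ℝ, eval z (hasse t (map (Int.castRingHom ℝ) Q)) =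
        ∑ i ∈ Q.support, (multichoose i t * coeff i Q) * ∏ j, z j ^ i j := by
      intro z
      conv_lhs => rw [Q.as_sum]
      rw [map_sum, map_sum, map_sum]
      refine sum_congr rfl fun i _ => ?_
      rw [map_monomial, hasse_monomial, eval_monomial,
        Finsupp.prod_fintype _ _ fun _ => pow_zero _, eq_intCast]
    rw [h1, h2, mul_sum]
    push_cast
    refine sum_congr rfl fun i hi => ?_
    have hiS : (∑ j, i j) / q ≤ S :=
      (Nat.div_le_self _ _).trans (sum_le_sum fun j _ => degreeOf_le_iff.mp (hr j) i hi)
    obtain ⟨e, he⟩ := Nat.exists_eq_add_of_le hiS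
    have hdeg : ∑ j, i j = q * ((∑ j, i j) / q) + s := by
      rw [← hs i hi, Nat.div_add_mod]
    have hprod : ∏ j, ((x j : ℝ) / α) ^ i j =
        (∏ j, (x j : ℝ) ^ i j) / ((k : ℝ) ^ (p * ((∑ j, i j) / q)) * α ^ s) := by
      rw [pow_mul, ← hαk, ← pow_mul, ← pow_add, ← hdeg, ← prod_pow_eq_pow_sum, ← prod_div_distrib]
      exact prod_congr rfl fun j _ => div_pow _ _ _
    have hk0' : (k : ℝ) ≠ 0 := by exact_mod_cast hk0.ne'
    rw [hprod, hκ]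
    simp only [he, Nat.add_sub_cancel_left, mul_add, pow_add]
    push_cast
    field_simp

end MvPolynomial

theorem Rat.pow_ne_natCast_pow {k p q : ℕ} (hk : 2 ≤ k) (hq : 0 < q) (hcop : Nat.Coprime p q)
    (hpow : ¬∃ m : ℕ, k = m ^ q) (x : ℚ) : x ^ q ≠ (k : ℚ) ^ p := by
  intro h
  have hk0 : (k : ℚ) ≠ 0 := by exact_mod_cast (by omega : k ≠ 0)
  have hx : x ≠ 0 := by
    rintro rfl
    rw [zero_pow hq.ne'] at h
    exact pow_ne_zero p hk0 h.symm
  set w := x ^ p.gcdA q * (k : ℚ) ^ p.gcdB q with hw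
  have hwq : w ^ q = k := by
    have hbez : (p : ℤ) * p.gcdA q + q * p.gcdB q = 1 := by
      rw [← Nat.gcd_eq_gcd_ab, hcop.gcd_eq_one, Nat.cast_one]
    calc w ^ q = (x ^ q) ^ p.gcdA q * (k : ℚ) ^ (q * p.gcdB q : ℤ) := by
          rw [hw, mul_pow, ← zpow_natCast, ← zpow_mul, ← zpow_natCast, ← zpow_mul, ← zpow_natCast x,
            ← zpow_mul, mul_comm (p.gcdA q), mul_comm (p.gcdB q)]
      _ = (k : ℚ) ^ ((p : ℤ) * p.gcdA q + q * p.gcdB q) := by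
          rw [h, ← zpow_natCast, ← zpow_mul, zpow_add₀ hk0]
      _ = k := by rw [hbez, zpow_one]
  refine hpow ⟨w.num.natAbs, ?_⟩
  have h1 := congrArg Rat.num hwq
  rw [Rat.num_pow, Rat.num_natCast] at h1
  have h2 := congrArg Int.natAbs h1
  rw [Int.natAbs_pow, Int.natAbs_natCast] at h2
  exact h2.symm

section Approximation

open Finset MvPolynomial

variable {k p q : ℕ} {α : ℝ}

/-- A Liouville-type lower bound for the denominators of good approximations. -/
theorem exists_pow_le_den_pow (hk : 2 ≤ k) (hq : 0 < q) (hα : 1 ≤ α)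
    (hαk : α ^ q = (k : ℝ) ^ p) (hx : ∀ x : ℚ, x ^ q ≠ (k : ℚ) ^ p) {ε : ℝ} (hε : 0 < ε) :
    ∃ N₀ : ℕ, ∀ N ≥ N₀, ∀ a : ℤ, |α - a / (k : ℝ) ^ N| < (k : ℝ) ^ (-((1 + ε) * N)) →
      (k : ℝ) ^ N ≤ (((a : ℚ) / (k : ℚ) ^ N).den : ℝ) ^ q := by
  have hk1 : (1 : ℝ) < k := by exact_mod_cast hk
  have hk0 : (0 : ℝ) < k := by linarith
  set A := q * (α + 1) ^ (q - 1) with hA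
  obtain ⟨N₀, hN₀⟩ := exists_nat_ge (Real.logb k A / ε)
  refine ⟨N₀, fun N hN a ha => ?_⟩
  set x : ℚ := (a : ℚ) / (k : ℚ) ^ N with hxdef
  have hxr : (x : ℝ) = a / (k : ℝ) ^ N := by rw [hxdef]; push_cast; rfl
  rw [← hxr] at ha
  have hA0 : 0 < A := by
    have : (0 : ℝ) < q := by exact_mod_cast hq
    positivity
  have hAN : A ≤ (k : ℝ) ^ (ε * N) := by
    rw [← Real.logb_le_iff_le_rpow hk1 hA0]
    have : (N₀ : ℝ) ≤ N := by exact_mod_cast hN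
    rw [div_le_iff₀ hε] at hN₀
    nlinarith
  have hsmall : (k : ℝ) ^ (-((1 + ε) * N)) ≤ 1 :=
    Real.rpow_le_one_of_one_le_of_nonpos hk1.le (by
      have : 0 ≤ (1 + ε) * N := by positivity
      linarith)
  have hD0 : (0 : ℝ) < (x.den : ℝ) ^ q := pow_pos (by exact_mod_cast x.den_pos) _
  have h1 : 1 ≤ (x.den : ℝ) ^ q * |α ^ q - (x : ℝ) ^ q| := by
    have hz : ((x.den : ℚ) ^ q * ((k : ℚ) ^ p - x ^ q)) =
        (((x.den : ℤ) ^ q * (k : ℤ) ^ p - x.num ^ q : ℤ) : ℚ) := by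
      push_cast
      rw [mul_sub, ← mul_pow, mul_comm (x.den : ℚ) x, Rat.mul_den_eq_num]
    have hne : ((x.den : ℤ) ^ q * (k : ℤ) ^ p - x.num ^ q : ℤ) ≠ 0 := by
      intro h0
      rw [h0, Int.cast_zero] at hz
      exact mul_ne_zero (pow_ne_zero _ (by exact_mod_cast x.den_nz))
        (sub_ne_zero.mpr (hx x).symm) hz
    have hz' : (x.den : ℝ) ^ q * (α ^ q - (x : ℝ) ^ q) =
        (((x.den : ℤ) ^ q * (k : ℤ) ^ p - x.num ^ q : ℤ) : ℝ) := by
      rw [hαk]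
      exact_mod_cast congrArg (Rat.cast : ℚ → ℝ) hz
    rw [← abs_of_pos hD0, ← abs_mul, hz']
    exact_mod_cast Int.one_le_abs hne
  have h2 : |α ^ q - (x : ℝ) ^ q| ≤ (k : ℝ) ^ (-((1 + ε) * N)) * A := by
    have hmax : max |α| |(x : ℝ)| ≤ α + 1 := by
      refine max_le ?_ ?_
      · rw [abs_of_pos (by linarith)]
        linarith
      · have := abs_sub_abs_le_abs_sub (x : ℝ) α
        rw [abs_sub_comm, abs_of_pos (by linarith : 0 < α)] at this
        linarith
    refine (abs_pow_sub_pow_le α (x : ℝ) q).trans ?_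
    rw [mul_assoc, hA]
    gcongr
  have h3 : (k : ℝ) ^ (-((1 + ε) * N)) * A ≤ (k : ℝ) ^ (-(N : ℝ)) := by
    calc _ ≤ (k : ℝ) ^ (-((1 + ε) * N)) * (k : ℝ) ^ (ε * N) := by gcongr
      _ = _ := by
        rw [← Real.rpow_add hk0]
        congr 1
        ring
  have h4 : 1 ≤ (x.den : ℝ) ^ q * ((k : ℝ) ^ N)⁻¹ := by
    have h5 : (k : ℝ) ^ (-(N : ℝ)) = ((k : ℝ) ^ N)⁻¹ := by
      rw [Real.rpow_neg hk0.le, Real.rpow_natCast]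
    rw [h5] at h3
    exact h1.trans (mul_le_mul_of_nonneg_left (h2.trans h3) hD0.le)
  rwa [← div_eq_mul_inv, one_le_div (pow_pos hk0 N)] at h4

theorem exists_lacunary_seq {good : ℕ → Prop} (h : ∀ n, ∃ N ≥ n, good N) (B : ℕ) {s : ℝ}
    (hs : 0 < s) : ∃ f : ℕ → ℕ, Monotone f ∧ (∀ n, good (f n)) ∧ B ≤ f 0 ∧
      ∀ a b, a < b → 2 * (f a : ℝ) ≤ s * f b := by
  choose g hg hgood using h
  set f : ℕ → ℕ := fun n => Nat.rec (g B) (fun _ y => g ⌈max 1 (2 / s) * y⌉₊) n with hf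
  have hstep : ∀ n, max 1 (2 / s) * (f n : ℝ) ≤ f (n + 1) := fun n =>
    (Nat.le_ceil _).trans (by exact_mod_cast hg _)
  have hmono : Monotone f := by
    refine monotone_nat_of_le_succ fun n => ?_
    have := hstep n
    have h1 : (f n : ℝ) ≤ max 1 (2 / s) * f n :=
      le_mul_of_one_le_left (Nat.cast_nonneg _) (le_max_left _ _)
    exact_mod_cast h1.trans this
  refine ⟨f, hmono, fun n => ?_, hg B, fun a b hab => ?_⟩
  · cases n with
    | zero => exact hgood _
    | succ n => exact hgood _
  · have h1 : 2 / s * f a ≤ f b :=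
      (mul_le_mul_of_nonneg_right (le_max_right 1 (2 / s)) (Nat.cast_nonneg _)).trans
        ((hstep a).trans (by exact_mod_cast hmono hab))
    rw [div_mul_eq_mul_div, div_le_iff₀ hs] at h1
    linarith

/-- The core of the argument: there is no long lacunary sequence of very good approximations with
denominators powers of `k`. -/
theorem not_lacunary_approximations (hk : 2 ≤ k) (hq : 0 < q) (hα : 1 ≤ α)
    (hαk : α ^ q = (k : ℝ) ^ p) {δ : ℝ} (hδ : 0 < δ) (hδ1 : δ ≤ 1 / 10) {m : ℕ} (hm : 0 < m)
    (hmq : 4 * q ≤ δ ^ 2 * m) {σ : ℝ} (hσ : 0 < σ)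
    (hroth : ∀ (r : Fin m → ℕ) (x : Fin m → ℚ) (P : MvPolynomial (Fin m) ℤ), P ≠ 0 →
      (∀ j, 0 < r j) → (∀ j, P.degreeOf j ≤ r j) → (∀ i j, i < j → (r i : ℝ) ≤ σ * r j) →
      (∀ j, x j ≠ 0) →
      (∀ j, (∑ l, (r l : ℝ)) + Real.log (l1 P) ≤ σ * r j * Real.log (x j).den) →
      ∃ μ : Fin m → ℕ, ∑ j, μ j * (r j : ℝ)⁻¹ ≤ δ * m / 2 ∧
        eval x (hasse μ (map (Int.castRingHom ℚ) P)) ≠ 0)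
    {B : ℕ} (hB0 : 0 < B) (hB1 : 2 * (2 * p + 6) ≤ δ * B) (hB2 : 2 * q * m * (p + 5) ≤ σ * B)
    (N : Fin m → ℕ) (hBN : ∀ j, B ≤ N j) (hN : ∀ i j, i < j → 2 * (N j : ℝ) ≤ σ * N i)
    (a : Fin m → ℤ)
    (ha : ∀ j, |α - a j / (k : ℝ) ^ N j| < (k : ℝ) ^ (-((1 + 10 * δ) * N j)))
    (hden : ∀ j, (k : ℝ) ^ N j ≤ (((a j : ℚ) / (k : ℚ) ^ N j).den : ℝ) ^ q) : False := by
  have hk1 : (1 : ℝ) < k := by exact_mod_cast hk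
  have hk0 : (0 : ℝ) < k := by linarith
  have hm0 : (0 : ℝ) < m := by exact_mod_cast hm
  have hq0 : (0 : ℝ) < q := by exact_mod_cast hq
  have hB0' : (0 : ℝ) < B := by exact_mod_cast hB0
  have hN0 : ∀ j, 0 < N j := fun j => hB0.trans_le (hBN j)
  have hN0' : ∀ j, (0 : ℝ) < N j := fun j => by exact_mod_cast hN0 j
  -- the degrees
  obtain ⟨R, hR⟩ := exists_nat_ge ((∑ j, (N j : ℝ)) / δ)
  have hNR : ∀ j, (N j : ℝ) ≤ δ * R := by
    intro j
    rw [div_le_iff₀ hδ] at hR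
    have := single_le_sum (f := fun j => (N j : ℝ)) (fun _ _ => Nat.cast_nonneg _) (mem_univ j)
    linarith
  have hR0 : (0 : ℝ) < R := by
    have := (hN0' ⟨0, hm⟩).trans_le (hNR ⟨0, hm⟩)
    exact (pos_iff_pos_of_mul_pos this).mp hδ
  set r : Fin m → ℕ := fun j => R / N j with hr
  have hrN : ∀ j, (r j : ℝ) * N j ≤ R := fun j => by exact_mod_cast Nat.div_mul_le_self R (N j)
  have hrN' : ∀ j, (1 - δ) * R ≤ r j * N j := by
    intro j
    have h1 : (R : ℝ) < (r j + 1) * N j := by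
      have := Nat.lt_div_mul_add (a := R) (hN0 j)
      have h2 : R < (R / N j + 1) * N j := by rw [add_mul, one_mul]; exact this
      exact_mod_cast h2
    have := hNR j
    linarith
  have hr0' : ∀ j, (0 : ℝ) < r j := by
    intro j
    have h1 : 0 < (r j : ℝ) * N j := lt_of_lt_of_le (mul_pos (by linarith) hR0) (hrN' j)
    exact (pos_iff_pos_of_mul_pos h1).mpr (hN0' j)
  have hr0 : ∀ j, 0 < r j := fun j => by exact_mod_cast hr0' j
  set S := ∑ j, r j with hS
  have hSB : (S : ℝ) * B ≤ m * R := by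
    rw [hS]
    push_cast
    rw [sum_mul]
    refine ((sum_le_sum fun j _ => ?_).trans
      (sum_le_card_nsmul univ _ (R : ℝ) fun j _ => hrN j)).trans (by simp)
    have : (B : ℝ) ≤ N j := by exact_mod_cast hBN j
    gcongr
  have hS1 : 1 ≤ S := (hr0 ⟨0, hm⟩).trans_le
    (single_le_sum (f := r) (fun _ _ => Nat.zero_le _) (mem_univ _))
  -- the auxiliary polynomial
  obtain ⟨s, hs, Q, hQ, hQdeg, hQl, hQs, hQw, hQvan⟩ :=
    exists_auxiliary_polynomial hm hq hδ (by linarith) hmq r hr0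
  obtain ⟨P, hP, hPQ, hPl, hPeval⟩ := exists_twist hk (by linarith) hαk Q hQ r hQdeg hQs
  set x : Fin m → ℚ := fun j => (a j : ℚ) / (k : ℚ) ^ N j with hx
  have hxr : ∀ j, (x j : ℝ) = a j / (k : ℝ) ^ N j := fun j => by simp [hx]
  have hsmall : ∀ j, (k : ℝ) ^ (-((1 + 10 * δ) * N j)) ≤ 1 := fun j =>
    Real.rpow_le_one_of_one_le_of_nonpos hk1.le (by
      have : 0 ≤ (1 + 10 * δ) * N j := by positivity
      linarith)
  have hxne : ∀ j, x j ≠ 0 := by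
    intro j h0
    have h1 := (ha j).trans_le (hsmall j)
    rw [← hxr, h0, Rat.cast_zero, sub_zero, abs_of_pos (by linarith)] at h1
    linarith
  have h8k : (8 : ℝ) ^ S ≤ (k : ℝ) ^ (3 * S) := by
    rw [pow_mul]
    have h2k : (2 : ℝ) ≤ k := by exact_mod_cast hk
    have : (8 : ℝ) ≤ (k : ℝ) ^ 3 := by
      calc (8 : ℝ) = 2 ^ 3 := by norm_num
        _ ≤ _ := by gcongr
    gcongr
  have hQl' : (l1 Q : ℝ) ≤ (k : ℝ) ^ (3 * S) :=
    le_trans (by exact_mod_cast hQl) h8k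
  have hratio : ∀ i j, i < j → (r i : ℝ) ≤ σ * r j := by
    intro i j hij
    refine le_of_mul_le_mul_right ?_ (hN0' i)
    have h1 : (r j : ℝ) * (2 * N j) ≤ r j * (σ * N i) :=
      mul_le_mul_of_nonneg_left (hN i j hij) (hr0' j).le
    have h2 : δ * R ≤ 1 / 10 * R := mul_le_mul_of_nonneg_right hδ1 hR0.le
    linarith [hrN i, hrN' j]
  have hlogk : 0 < Real.log k := Real.log_pos hk1
  have hlog : ∀ j, (∑ l, (r l : ℝ)) + Real.log (l1 P) ≤ σ * r j * Real.log (x j).den := by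
    intro j
    have hP0 : (0 : ℝ) < l1 P := by exact_mod_cast one_le_l1 hP
    have h1 : Real.log (l1 P) ≤ (p + 3) * S * Real.log k := by
      have hle : (l1 P : ℝ) ≤ (k : ℝ) ^ ((p + 3) * S) := by
        calc (l1 P : ℝ) ≤ (k : ℝ) ^ (p * S) * l1 Q := by exact_mod_cast hPl
          _ ≤ (k : ℝ) ^ (p * S) * (k : ℝ) ^ (3 * S) := by gcongr
          _ = _ := by rw [← pow_add, add_mul]
      refine (Real.log_le_log hP0 hle).trans_eq ?_
      rw [Real.log_pow]
      push_cast
      ring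
    have h2 : 1 ≤ 2 * Real.log k := by
      have := Real.log_le_log two_pos (by exact_mod_cast hk : (2 : ℝ) ≤ k)
      linarith [Real.log_two_gt_d9]
    have h3 : N j * Real.log k ≤ q * Real.log (x j).den := by
      rw [← Real.log_pow, ← Real.log_pow]
      exact Real.log_le_log (pow_pos hk0 _) (hden j)
    have h4 : (∑ l, (r l : ℝ)) = S := by
      rw [hS]
      push_cast
      rfl
    have hS0 : (0 : ℝ) ≤ S := Nat.cast_nonneg _
    have h5 : 2 * q * (p + 5) * (S : ℝ) ≤ σ * R := by
      refine le_of_mul_le_mul_left ?_ hm0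
      have h6 := mul_le_mul_of_nonneg_right hB2 hS0
      have h7 := mul_le_mul_of_nonneg_left hSB hσ.le
      linarith
    have h6 : σ * (R / 2) ≤ σ * (r j * N j) := by
      refine mul_le_mul_of_nonneg_left ?_ hσ.le
      have : δ * R ≤ 1 / 10 * R := mul_le_mul_of_nonneg_right hδ1 hR0.le
      linarith [hrN' j]
    refine le_of_mul_le_mul_left ?_ hq0
    calc q * ((∑ l, (r l : ℝ)) + Real.log (l1 P))
        ≤ q * (S * (2 * Real.log k) + (p + 3) * S * Real.log k) := by
          rw [h4]
          gcongr
          exact le_mul_of_one_le_right hS0 h2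
      _ = q * (p + 5) * S * Real.log k := by ring
      _ ≤ σ * (r j * N j) * Real.log k := by
          refine mul_le_mul_of_nonneg_right ?_ hlogk.le
          linarith
      _ = σ * r j * (N j * Real.log k) := by ring
      _ ≤ σ * r j * (q * Real.log (x j).den) :=
          mul_le_mul_of_nonneg_left h3 (mul_nonneg hσ.le (hr0' j).le)
      _ = _ := by ring
  obtain ⟨t, ht, htne⟩ := hroth r x P hP hr0
    (fun j => degreeOf_le_iff.mpr fun i hi => degreeOf_le_iff.mp (hQdeg j) i (hPQ hi))
    hratio hxne hlog
  -- the lower bound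
  set M := ⌊R * (m / 2 * (1 + δ))⌋₊ with hM
  have hMle : (M : ℝ) ≤ R * (m / 2 * (1 + δ)) := Nat.floor_le (by positivity)
  have hwt : ∀ i ∈ (hasse t P).support, ∑ j, i j * N j ≤ M := by
    intro i hi
    refine Nat.le_floor ?_
    push_cast
    refine le_trans ?_ (mul_le_mul_of_nonneg_left (hQw i (hPQ (support_hasse_subset _ _ hi)))
      hR0.le)
    rw [mul_sum]
    refine sum_le_sum fun j _ => ?_
    rw [mul_left_comm]
    gcongr
    rw [← div_eq_mul_inv, le_div_iff₀ (hr0' j), mul_comm]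
    exact hrN j
  rw [← map_hasse] at htne
  have hlow := one_le_pow_mul_abs_eval (hasse t P) (by omega) a N M hwt htne
  rw [map_hasse] at hlow
  -- the upper bound
  set E := (1 + 10 * δ) * ((1 - δ) * R) with hE
  have hE0 : 0 ≤ E := mul_nonneg (by linarith) (mul_nonneg (by linarith) hR0.le)
  set θ := (m : ℝ) / 2 * (1 - δ) - ∑ j, t j * (r j : ℝ)⁻¹ with hθ
  have hd : ∀ j, |(x j : ℝ) / α - 1| ≤ (k : ℝ) ^ (-(E * (r j : ℝ)⁻¹)) := by
    intro j
    have hα0 : 0 < α := by linarith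
    calc |(x j : ℝ) / α - 1| = |α - x j| / α := by
          rw [abs_sub_comm α, ← abs_of_pos hα0, ← abs_div, abs_of_pos hα0, sub_div,
            div_self hα0.ne']
      _ ≤ |α - x j| := div_le_self (abs_nonneg _) hα
      _ ≤ (k : ℝ) ^ (-((1 + 10 * δ) * N j)) := by
          rw [hxr]
          exact (ha j).le
      _ ≤ _ := by
          refine Real.rpow_le_rpow_of_exponent_le hk1.le (neg_le_neg ?_)
          rw [hE, mul_assoc]
          refine mul_le_mul_of_nonneg_left ?_ (by linarith)
          rw [← div_eq_mul_inv, div_le_iff₀ (hr0' j), mul_comm (N j : ℝ)]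
          exact hrN' j
  have hup := hQvan.abs_eval_one_add_le (fun j => by positivity) r hQdeg t hk1.le hE0 _ hd
  simp only [add_sub_cancel] at hup
  have hαs : α ^ s ≤ (k : ℝ) ^ (p * S) := by
    calc α ^ s ≤ α ^ q := pow_le_pow_right₀ hα hs.le
      _ = (k : ℝ) ^ p := hαk
      _ ≤ _ := pow_le_pow_right₀ hk1.le (Nat.le_mul_of_pos_right p hS1)
  have hlow' := (Rat.cast_le (K := ℝ)).mpr hlow
  push_cast at hlow'
  rw [hPeval, abs_mul, abs_of_pos (by positivity)] at hlow'
  have hone : (1 : ℝ) ≤ (k : ℝ) ^ ((M + (2 * p + 6) * S : ℕ) + -(E * θ) : ℝ) := by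
    calc (1 : ℝ) ≤ _ := hlow'
      _ ≤ (k : ℝ) ^ M * ((k : ℝ) ^ (p * S) * (k : ℝ) ^ (p * S) *
          ((k : ℝ) ^ (3 * S) * (k : ℝ) ^ (3 * S) * (k : ℝ) ^ (-(E * θ)))) := by
        refine mul_le_mul_of_nonneg_left (mul_le_mul
          (mul_le_mul_of_nonneg_left hαs (by positivity)) (hup.trans ?_) (abs_nonneg _)
          (by positivity)) (by positivity)
        gcongr
      _ = _ := by
        rw [Real.rpow_add hk0, Real.rpow_natCast]
        ring
  have hexp : E * θ ≤ M + (2 * p + 6) * S := by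
    by_contra! h
    have := Real.rpow_lt_one_of_one_lt_of_neg hk1
      (show ((M + (2 * p + 6) * S : ℕ) + -(E * θ) : ℝ) < 0 by push_cast; linarith)
    linarith
  have hθ' : (m : ℝ) / 2 * (1 - 2 * δ) ≤ θ := by
    rw [hθ]
    linarith
  have hS' : (2 * p + 6) * (S : ℝ) ≤ R * (m / 2 * δ) := by
    have h1 := mul_le_mul_of_nonneg_right hB1 (Nat.cast_nonneg (α := ℝ) S)
    have h2 := mul_le_mul_of_nonneg_left hSB hδ.le
    linarith
  have hfin : R * (m / 2) * ((1 + 10 * δ) * (1 - δ) * (1 - 2 * δ)) ≤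
      R * (m / 2) * (1 + 2 * δ) := by
    have := mul_le_mul_of_nonneg_left hθ' hE0
    rw [hE] at this hexp
    linarith
  have := le_of_mul_le_mul_left hfin (by positivity)
  nlinarith [mul_pos hδ hδ, mul_pos hδ (mul_pos hδ hδ)]

theorem exists_forall_rpow_le_abs_sub (hk : 2 ≤ k) (hq : 0 < q) (hα : 1 ≤ α)
    (hαk : α ^ q = (k : ℝ) ^ p) (hx : ∀ x : ℚ, x ^ q ≠ (k : ℚ) ^ p) {δ : ℝ} (hδ : 0 < δ)
    (hδ1 : δ ≤ 1 / 10) :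
    ∃ N₀ : ℕ, ∀ N ≥ N₀, ∀ a : ℤ,
      (k : ℝ) ^ (-((1 + 10 * δ) * N)) ≤ |α - a / (k : ℝ) ^ N| := by
  set m := ⌈4 * (q : ℝ) / δ ^ 2⌉₊ + 1 with hm
  have hm0 : (0 : ℝ) < m := by exact_mod_cast Nat.succ_pos _
  have hmq : 4 * q ≤ δ ^ 2 * m := by
    have h1 : 4 * (q : ℝ) / δ ^ 2 ≤ m := (Nat.le_ceil _).trans (Nat.cast_le.mpr (Nat.le_succ _))
    rw [div_le_iff₀ (by positivity)] at h1
    linarith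
  obtain ⟨σ, hσ, hroth⟩ := roth_lemma m (δ * m / 2) (by positivity)
  obtain ⟨N₁, hN₁⟩ := exists_pow_le_den_pow hk hq hα hαk hx (ε := 10 * δ) (by positivity)
  obtain ⟨b₁, hb₁⟩ := exists_nat_ge (2 * (2 * p + 6) / δ)
  obtain ⟨b₂, hb₂⟩ := exists_nat_ge (2 * q * m * (p + 5) / σ)
  rw [div_le_iff₀ hδ] at hb₁
  rw [div_le_iff₀ hσ] at hb₂
  set B := N₁ + b₁ + b₂ + 1 with hB
  by_contra! hcon
  obtain ⟨f, hfmono, hfgood, hfB, hflac⟩ := exists_lacunary_seq hcon B hσ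
  choose a ha using hfgood
  have hBf : ∀ n, B ≤ f n := fun n => hfB.trans (hfmono n.zero_le)
  have hB₁ : (b₁ : ℝ) ≤ B := by exact_mod_cast (by omega : b₁ ≤ B)
  have hB₂ : (b₂ : ℝ) ≤ B := by exact_mod_cast (by omega : b₂ ≤ B)
  refine not_lacunary_approximations hk hq hα hαk hδ hδ1 (Nat.succ_pos _) hmq hσ hroth
    (B := B) (Nat.succ_pos _) ?_ ?_ (fun j => f (Fin.rev j)) (fun j => hBf _)
    (fun i j hij => hflac _ _ (Fin.rev_lt_rev.mpr hij)) (fun j => a (Fin.rev j))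
    (fun j => ha _) (fun j => hN₁ _ ?_ _ (ha _))
  · have := mul_le_mul_of_nonneg_left hB₁ hδ.le
    linarith
  · have := mul_le_mul_of_nonneg_left hB₂ hσ.le
    linarith
  · have := hBf (Fin.rev j)
    omega

/-- A lower bound for the approximations with bounded denominators. -/
theorem exists_forall_lt_le_abs_sub (hk : 0 < k) (hα : Irrational α) (N₀ : ℕ) :
    ∃ C > 0, ∀ N < N₀, ∀ a : ℤ, C ≤ |α - a / (k : ℝ) ^ N| := by
  have hk0 : (0 : ℝ) < k := by exact_mod_cast hk
  induction N₀ with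
  | zero => exact ⟨1, one_pos, fun N hN => absurd hN N.not_lt_zero⟩
  | succ n ih =>
    obtain ⟨C, hC, h⟩ := ih
    set y := α * (k : ℝ) ^ n with hy
    have hy_pos : 0 < |y - round y| := by
      rw [abs_pos, sub_ne_zero]
      have : Irrational y := by
        rw [hy, ← Nat.cast_pow]
        exact hα.mul_natCast (pow_pos hk n).ne'
      exact this.ne_int _
    refine ⟨min C (|y - round y| / (k : ℝ) ^ n), lt_min hC (by positivity), fun N hN a => ?_⟩
    rcases (Nat.lt_succ_iff_lt_or_eq.mp hN) with hN | rfl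
    · exact (min_le_left _ _).trans (h N hN a)
    · refine (min_le_right _ _).trans ?_
      have hkn : (0 : ℝ) < (k : ℝ) ^ N := pow_pos hk0 N
      rw [div_le_iff₀ hkn, ← abs_of_pos hkn, ← abs_mul, abs_of_pos hkn, sub_mul,
        div_mul_cancel₀ _ hkn.ne']
      exact round_le y a

theorem exists_forall_mul_rpow_le_abs_sub (hk : 2 ≤ k) (hq : 0 < q) (hα : 1 ≤ α)
    (hαk : α ^ q = (k : ℝ) ^ p) (hx : ∀ x : ℚ, x ^ q ≠ (k : ℚ) ^ p) {ε : ℝ} (hε : 0 < ε) :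
    ∃ C > 0, ∀ (a : ℤ) (N : ℕ),
      C * (k : ℝ) ^ (-((1 + ε) * N)) ≤ |α - a / (k : ℝ) ^ N| := by
  have hk1 : (1 : ℝ) < k := by exact_mod_cast hk
  have hirr : Irrational α := by
    rintro ⟨x, rfl⟩
    exact hx x (by exact_mod_cast hαk)
  obtain ⟨N₀, hN₀⟩ := exists_forall_rpow_le_abs_sub hk hq hα hαk hx (δ := min ε 1 / 10)
    (by positivity) (by gcongr; exact min_le_right _ _)
  obtain ⟨C, hC, h⟩ := exists_forall_lt_le_abs_sub (by omega : 0 < k) hirr N₀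
  refine ⟨min C 1, lt_min hC one_pos, fun a N => ?_⟩
  rcases lt_or_ge N N₀ with hN | hN
  · refine le_trans ?_ (h N hN a)
    refine (mul_le_mul_of_nonneg_right (min_le_left C 1) (by positivity)).trans
      (mul_le_of_le_one_right hC.le (Real.rpow_le_one_of_one_le_of_nonpos hk1.le ?_))
    have : 0 ≤ (1 + ε) * N := by positivity
    linarith
  · refine le_trans ?_ (hN₀ N hN a)
    refine (mul_le_of_le_one_left (by positivity) (min_le_right C 1)).trans
      (Real.rpow_le_rpow_of_exponent_le hk1.le (neg_le_neg ?_))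
    rw [mul_div_cancel₀ _ (by norm_num)]
    gcongr
    exact min_le_left _ _

end Approximation

/-- consequence of Ridout's theorem: if `k ≥ 2` is not a `q`-th power
and `1 ≤ p < q` with `gcd(p,q) = 1`, then for every `ε > 0` there is `C > 0` with
`|k^{p/q} - a/k^N| ≥ C k^{-(1+ε)N}` for all integers `a` and all `N ≥ 0`. -/
theorem stmt_16 (k : ℕ) (hk : 2 ≤ k) (p q : ℕ) (hcop : Nat.Coprime p q)
    (hp : 1 ≤ p) (hpq : p < q) (hpow : ¬∃ m : ℕ, k = m ^ q) :
    ∀ ε : ℝ, 0 < ε → ∃ C : ℝ, 0 < C ∧ ∀ (a : ℤ) (N : ℕ),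
      C * (k : ℝ) ^ (-((1 + ε) * N)) ≤
        |(k : ℝ) ^ ((p : ℝ) / (q : ℝ)) - (a : ℝ) / (k : ℝ) ^ N| := by
  intro ε hε
  have hq : 0 < q := by omega
  have hk1 : (1 : ℝ) ≤ k := by exact_mod_cast (by omega : 1 ≤ k)
  refine exists_forall_mul_rpow_le_abs_sub hk hq
    (Real.one_le_rpow hk1 (by positivity)) ?_ (Rat.pow_ne_natCast_pow hk hq hcop hpow) hε
  rw [← Real.rpow_natCast, ← Real.rpow_mul (by positivity), div_mul_cancel₀ _ (by positivity),
    Real.rpow_natCast]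
end
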